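/- arXiv:2502.13486 — 10 statements merged into one kernel-verified Lean document; each statement's English description precedes it below -/
import Mathlib

section
/- Let γ_n (n ∈ ℕ) and γ be stochastic kernels from Y to U. Then γ_n converges to γ in the w*-topology if and only if γ_n converges to γ in the Young narrow topology; that is, ∫_Y ∫_U f(y)(u) γ_n(y)(du) dμ(y) → ∫_Y ∫_U f(y)(u) γ(y)(du) dμ(y) holds for every f ∈ L¹(μ, C₀(U)) if and only if it holds for every f ∈ L¹(μ, C_b(U)). -/
open MeasureTheory Filter Topology
open scoped ZeroAtInfty

/-- A pointwise kernel integral of a strongly measurable bounded-continuous-function-valued map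
is strongly measurable. -/
theorem aestronglyMeasurable_integral_kernel_boundedContinuous
    {Y U : Type*} [MeasurableSpace Y]
    [TopologicalSpace U] [PolishSpace U] [MeasurableSpace U] [BorelSpace U]
    {μ : Measure Y} (κ : ProbabilityTheory.Kernel Y U) [ProbabilityTheory.IsMarkovKernel κ]
    {f : Y → BoundedContinuousFunction U ℝ} (hf : AEStronglyMeasurable f μ) :
    AEStronglyMeasurable (fun y => ∫ u, f y u ∂(κ y)) μ := by
  obtain ⟨g, hg, hfg⟩ := hf
  refine ⟨fun y => ∫ u, g y u ∂(κ y), ?_, ?_⟩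
  · have h1 : StronglyMeasurable (fun p : Y × U => (g p.1, p.2)) :=
      (hg.comp_measurable measurable_fst).prodMk measurable_snd.stronglyMeasurable
    have h2 : StronglyMeasurable (fun p : Y × U => g p.1 p.2) :=
      (ContinuousEval.continuous_eval (F := BoundedContinuousFunction U ℝ))
        |>.comp_stronglyMeasurable h1
    exact h2.integral_kernel_prod_right
  · filter_upwards [hfg] with y hy
    rw [hy]

/-- The kernel integral of a Bochner integrable family of bounded continuous functions is
integrable. -/
theorem integrable_integral_kernel_boundedContinuous
    {Y U : Type*} [MeasurableSpace Y]
    [TopologicalSpace U] [PolishSpace U] [MeasurableSpace U] [BorelSpace U]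
    {μ : Measure Y} (κ : ProbabilityTheory.Kernel Y U) [ProbabilityTheory.IsMarkovKernel κ]
    {f : Y → BoundedContinuousFunction U ℝ} (hf : Integrable f μ) :
    Integrable (fun y => ∫ u, f y u ∂(κ y)) μ := by
  refine hf.norm.mono' (aestronglyMeasurable_integral_kernel_boundedContinuous κ hf.1) ?_
  filter_upwards with y
  exact (f y).norm_integral_le_norm (κ y)

/-- Embedding into the bounded continuous functions preserves Bochner integrability. -/
theorem integrable_toBCF {Y U : Type*} [MeasurableSpace Y] [TopologicalSpace U]
    {μ : Measure Y} {f : Y → C₀(U, ℝ)} (hf : Integrable f μ) :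
    Integrable (fun y => (f y).toBCF) μ := by
  refine hf.norm.mono' ?_ ?_
  · exact ZeroAtInftyContinuousMap.isometry_toBCF.continuous.comp_aestronglyMeasurable hf.1
  · filter_upwards with y
    exact le_of_eq rfl

/-- The product of a bounded continuous function with a function vanishing at infinity. -/
def mulZeroAtInfty {U : Type*} [TopologicalSpace U] (χ : C₀(U, ℝ))
    (f : BoundedContinuousFunction U ℝ) : C₀(U, ℝ) where
  toFun u := f u * χ u
  continuous_toFun := f.continuous.mul χ.continuous
  zero_at_infty' := by
    refine squeeze_zero_norm (a := fun u => ‖f‖ * ‖χ u‖) (fun u => ?_) ?_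
    · rw [norm_mul]
      exact mul_le_mul_of_nonneg_right (f.norm_coe_le_norm u) (norm_nonneg _)
    · simpa using (χ.zero_at_infty'.norm).const_mul ‖f‖

theorem integrable_mulZeroAtInfty {Y U : Type*} [MeasurableSpace Y] [TopologicalSpace U]
    {μ : Measure Y} {f : Y → BoundedContinuousFunction U ℝ} (hf : Integrable f μ)
    {χ : C₀(U, ℝ)} (hχ : ∀ u, χ u ∈ Set.Icc (0 : ℝ) 1) :
    Integrable (fun y => mulZeroAtInfty χ (f y)) μ := by
  have hL : LipschitzWith 1 (mulZeroAtInfty χ) := by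
    refine LipschitzWith.of_dist_le_mul fun f g => ?_
    rw [← ZeroAtInftyContinuousMap.dist_toBCF_eq_dist, NNReal.coe_one, one_mul]
    refine (BoundedContinuousFunction.dist_le dist_nonneg).2 fun u => ?_
    change dist (f u * χ u) (g u * χ u) ≤ _
    rw [Real.dist_eq, ← sub_mul, abs_mul, abs_of_nonneg (hχ u).1]
    exact (mul_le_of_le_one_right (abs_nonneg _) (hχ u).2).trans
      ((Real.dist_eq _ _).symm.trans_le (BoundedContinuousFunction.dist_coe_le_dist u))
  have h0 : mulZeroAtInfty χ 0 = 0 := by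
    ext u
    change (0 : ℝ) * χ u = 0
    simp
  refine hf.norm.mono' (hL.continuous.comp_aestronglyMeasurable hf.1) ?_
  filter_upwards with y
  simpa [h0] using hL.dist_le_mul (f y) 0

/-- A σ-compact locally compact Hausdorff space carries a sequence of cut-off functions
converging pointwise to one. -/
theorem exists_zeroAtInfty_tendsto_one (U : Type*) [TopologicalSpace U] [T2Space U]
    [LocallyCompactSpace U] [SigmaCompactSpace U] :
    ∃ χ : ℕ → C₀(U, ℝ), (∀ k u, χ k u ∈ Set.Icc (0 : ℝ) 1) ∧
      ∀ u, Tendsto (fun k => χ k u) atTop (𝓝 1) := by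
  let K : CompactExhaustion U := default
  have h (k : ℕ) : ∃ χ : C₀(U, ℝ), (∀ u, χ u ∈ Set.Icc (0 : ℝ) 1) ∧ ∀ u ∈ K k, χ u = 1 := by
    obtain ⟨g, hg1, -, hgc, hg⟩ := exists_continuous_one_zero_of_isCompact (K.isCompact k)
      isClosed_empty (Set.disjoint_empty _)
    exact ⟨⟨g, hgc.is_zero_at_infty⟩, hg, hg1⟩
  choose χ hχ hχ1 using h
  refine ⟨χ, hχ, fun u => tendsto_const_nhds.congr' ?_⟩
  obtain ⟨m, hm⟩ := K.exists_mem u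
  filter_upwards [eventually_ge_atTop m] with k hk
  exact (hχ1 k u (K.subset hk hm)).symm

/-- The truncation error of a kernel integral is controlled by the mass lost by the cut-off,
weighted with the norm of the integrand. -/
theorem abs_integral_sub_integral_mulZeroAtInfty_le
    {Y U : Type*} [MeasurableSpace Y]
    [TopologicalSpace U] [PolishSpace U] [MeasurableSpace U] [BorelSpace U]
    {μ : Measure Y} (κ : ProbabilityTheory.Kernel Y U) [ProbabilityTheory.IsMarkovKernel κ]
    {f : Y → BoundedContinuousFunction U ℝ} (hf : Integrable f μ)
    {χ : C₀(U, ℝ)} (hχ : ∀ u, χ u ∈ Set.Icc (0 : ℝ) 1) :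
    |∫ y, ∫ u, f y u ∂(κ y) ∂μ - ∫ y, ∫ u, mulZeroAtInfty χ (f y) u ∂(κ y) ∂μ| ≤
      ∫ y, ‖f y‖ ∂μ - ∫ y, ∫ u, (‖f y‖ • χ) u ∂(κ y) ∂μ := by
  have hfχ := integrable_integral_kernel_boundedContinuous κ
    (integrable_toBCF (integrable_mulZeroAtInfty hf hχ))
  have hMχ := integrable_integral_kernel_boundedContinuous κ
    (integrable_toBCF (hf.norm.smul_const χ))
  have hf' := integrable_integral_kernel_boundedContinuous κ hf
  change Integrable (fun y => ∫ u, mulZeroAtInfty χ (f y) u ∂(κ y)) μ at hfχ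
  change Integrable (fun y => ∫ u, (‖f y‖ • χ) u ∂(κ y)) μ at hMχ
  rw [← integral_sub hf' hfχ, ← integral_sub hf.norm hMχ, ← Real.norm_eq_abs]
  refine norm_integral_le_of_norm_le (hf.norm.sub hMχ) ?_
  filter_upwards with y
  have i1 : Integrable (fun u => f y u) (κ y) := (f y).integrable (κ y)
  have i2 : Integrable (fun u => mulZeroAtInfty χ (f y) u) (κ y) :=
    (mulZeroAtInfty χ (f y)).toBCF.integrable (κ y)
  have i3 : Integrable (fun u => (‖f y‖ • χ) u) (κ y) := (‖f y‖ • χ).toBCF.integrable (κ y)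
  have e : ‖f y‖ - ∫ u, (‖f y‖ • χ) u ∂(κ y) = ∫ u, (‖f y‖ - (‖f y‖ • χ) u) ∂(κ y) := by
    rw [integral_sub (integrable_const _) i3, integral_const, probReal_univ, one_smul]
  rw [← integral_sub i1 i2, e]
  refine norm_integral_le_of_norm_le ((integrable_const _).sub i3) ?_
  filter_upwards with u
  change ‖f y u - f y u * χ u‖ ≤ ‖f y‖ - ‖f y‖ * χ u
  have h : 0 ≤ 1 - χ u := sub_nonneg.2 (hχ u).2
  rw [← mul_one_sub, ← mul_one_sub, norm_mul, Real.norm_of_nonneg h]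
  exact mul_le_mul_of_nonneg_right ((f y).norm_coe_le_norm u) h

/-- The weighted mass captured by cut-off functions tends to the full weight. -/
theorem tendsto_integral_smul_zeroAtInfty
    {Y U : Type*} [MeasurableSpace Y]
    [TopologicalSpace U] [PolishSpace U] [MeasurableSpace U] [BorelSpace U]
    {μ : Measure Y} (κ : ProbabilityTheory.Kernel Y U) [ProbabilityTheory.IsMarkovKernel κ]
    {M : Y → ℝ} (hM : Integrable M μ)
    {χ : ℕ → C₀(U, ℝ)} (hχ : ∀ k u, χ k u ∈ Set.Icc (0 : ℝ) 1)
    (hlim : ∀ u, Tendsto (fun k => χ k u) atTop (𝓝 1)) :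
    Tendsto (fun k => ∫ y, ∫ u, (M y • χ k) u ∂(κ y) ∂μ) atTop (𝓝 (∫ y, M y ∂μ)) := by
  have hb (k : ℕ) (y : Y) (u : U) : ‖(M y • χ k) u‖ ≤ ‖M y‖ := by
    change ‖M y * χ k u‖ ≤ _
    rw [norm_mul, Real.norm_of_nonneg (hχ k u).1]
    exact mul_le_of_le_one_right (norm_nonneg _) (hχ k u).2
  refine tendsto_integral_of_dominated_convergence (fun y => ‖M y‖) (fun k => ?_) hM.norm
    (fun k => ?_) ?_
  · exact (integrable_integral_kernel_boundedContinuous κ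
      (integrable_toBCF (hM.smul_const (χ k)))).1
  · filter_upwards with y
    refine (norm_integral_le_of_norm_le (integrable_const ‖M y‖)
      (Eventually.of_forall (hb k y))).trans ?_
    simp
  · filter_upwards with y
    have e : M y = ∫ _, M y ∂(κ y) := by simp
    conv_rhs => rw [e]
    refine tendsto_integral_of_dominated_convergence (fun _ => ‖M y‖) (fun k => ?_)
      (integrable_const _) (fun k => Eventually.of_forall (hb k y)) ?_
    · exact ((M y • χ k).continuous.stronglyMeasurable).aestronglyMeasurable
    · filter_upwards with u
      simpa using (hlim u).const_mul (M y)

/-- For stochastic kernels `γₙ, γ` from a Polish space `Y` (with Borel probability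
measure `μ`) to a locally compact Polish space `U`, convergence in the `w*`-topology
(testing against all `f ∈ L¹(μ, C₀(U))`) is equivalent to convergence in the Young narrow
topology (testing against all `f ∈ L¹(μ, C_b(U))`). -/
theorem stmt0
    {Y U : Type*} [TopologicalSpace Y] [PolishSpace Y] [MeasurableSpace Y] [BorelSpace Y]
    [TopologicalSpace U] [PolishSpace U] [LocallyCompactSpace U]
    [MeasurableSpace U] [BorelSpace U]
    (μ : Measure Y) [IsProbabilityMeasure μ]
    (γn : ℕ → Y → Measure U) (γ : Y → Measure U)
    (hγn_meas : ∀ n, ∀ D : Set U, MeasurableSet D → Measurable fun y => γn n y D)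
    (hγn_prob : ∀ n y, IsProbabilityMeasure (γn n y))
    (hγ_meas : ∀ D : Set U, MeasurableSet D → Measurable fun y => γ y D)
    (hγ_prob : ∀ y, IsProbabilityMeasure (γ y)) :
    (∀ f : Y → C₀(U, ℝ), Integrable f μ →
      Tendsto (fun n => ∫ y, ∫ u, f y u ∂(γn n y) ∂μ) atTop
        (𝓝 (∫ y, ∫ u, f y u ∂(γ y) ∂μ)))
    ↔ (∀ f : Y → BoundedContinuousFunction U ℝ, Integrable f μ →
      Tendsto (fun n => ∫ y, ∫ u, f y u ∂(γn n y) ∂μ) atTop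
        (𝓝 (∫ y, ∫ u, f y u ∂(γ y) ∂μ))) := by
  let κn (n : ℕ) : ProbabilityTheory.Kernel Y U :=
    ⟨γn n, Measure.measurable_of_measurable_coe _ (hγn_meas n)⟩
  let κ : ProbabilityTheory.Kernel Y U := ⟨γ, Measure.measurable_of_measurable_coe _ hγ_meas⟩
  have hκn (n : ℕ) : ProbabilityTheory.IsMarkovKernel (κn n) := ⟨hγn_prob n⟩
  have hκ : ProbabilityTheory.IsMarkovKernel κ := ⟨hγ_prob⟩
  refine ⟨fun H f hf => ?_, fun H f hf => H (fun y => (f y).toBCF) (integrable_toBCF hf)⟩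
  obtain ⟨χ, hχ, hlim⟩ := exists_zeroAtInfty_tendsto_one U
  have hM := tendsto_integral_smul_zeroAtInfty κ hf.norm hχ hlim
  rw [Metric.tendsto_nhds]
  intro ε hε
  obtain ⟨k, hk⟩ := ((Metric.tendsto_nhds.1 hM) (ε / 6) (by positivity)).exists
  have h1 := Metric.tendsto_nhds.1 (H _ (integrable_mulZeroAtInfty hf (hχ k))) (ε / 3)
    (by positivity)
  have h2 := Metric.tendsto_nhds.1 (H _ (hf.norm.smul_const (χ k))) (ε / 6) (by positivity)
  have h3 := abs_integral_sub_integral_mulZeroAtInfty_le κ hf (hχ k)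
  filter_upwards [h1, h2] with n h1 h2
  have h4 := abs_integral_sub_integral_mulZeroAtInfty_le (κn n) hf (hχ k)
  change |_ - ∫ y, ∫ u, mulZeroAtInfty (χ k) (f y) u ∂(γ y) ∂μ| ≤
    _ - ∫ y, ∫ u, (‖f y‖ • χ k) u ∂(γ y) ∂μ at h3
  change |_ - ∫ y, ∫ u, mulZeroAtInfty (χ k) (f y) u ∂(γn n y) ∂μ| ≤
    _ - ∫ y, ∫ u, (‖f y‖ • χ k) u ∂(γn n y) ∂μ at h4
  change dist (∫ y, ∫ u, (‖f y‖ • χ k) u ∂(γ y) ∂μ) _ < _ at hk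
  rw [Real.dist_eq, abs_lt] at *
  rw [abs_le] at h3 h4
  change _ ≤ (∫ y, ∫ u, f y u ∂(γ y) ∂μ) - _ ∧ (∫ y, ∫ u, f y u ∂(γ y) ∂μ) - _ ≤ _ at h3
  change _ ≤ (∫ y, ∫ u, f y u ∂(γn n y) ∂μ) - _ ∧
    (∫ y, ∫ u, f y u ∂(γn n y) ∂μ) - _ ≤ _ at h4
  constructor <;> linarith [h1.1, h1.2, h2.1, h2.2, h3.1, h3.2, h4.1, h4.2, hk.1, hk.2]
end

section
/- Let γ_n (n ∈ ℕ) and γ be stochastic kernels from Y to U. Then γ_n converges to γ in the weak kernel mean embedding topology (i.e., ∫_Y ⟪I(γ_n(y)), g(y)⟫ dμ(y) → ∫_Y ⟪I(γ(y)), g(y)⟫ dμ(y) for every g ∈ L¹(μ, H)) if and only if γ_n converges to γ in the w*-topology (i.e., ∫_Y ∫_U f(y)(u) γ_n(y)(du) dμ(y) → ∫_Y ∫_U f(y)(u) γ(y)(du) dμ(y) for every f ∈ L¹(μ, C₀(U))). -/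
open MeasureTheory Filter Topology
open scoped ZeroAtInfty RealInnerProductSpace

section KernelMeanEmbedding

open ProbabilityTheory

variable {Y U H : Type*} [MeasurableSpace Y] [TopologicalSpace U]
  [NormedAddCommGroup H] [InnerProductSpace ℝ H]

lemma ZeroAtInftyContinuousMap.continuous_uncurry_apply :
    Continuous fun p : C₀(U, ℝ) × U => p.1 p.2 :=
  (continuous_eval (F := BoundedContinuousFunction U ℝ)).comp
    ((ZeroAtInftyContinuousMap.isometry_toBCF.continuous.comp continuous_fst).prodMk
      continuous_snd)

lemma ZeroAtInftyContinuousMap.norm_apply_le (f : C₀(U, ℝ)) (u : U) : ‖f u‖ ≤ ‖f‖ :=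
  f.toBCF.norm_coe_le_norm u

/-- The linear map `h ↦ ⟪h, Φ ·⟫` into `C₀(U, ℝ)` induced by a bounded feature map, as a
continuous linear map. -/
noncomputable def featureCLM (Φ : U → H) (M : ℝ) (hM : ∀ u, ‖Φ u‖ ≤ M)
    (T : H → C₀(U, ℝ)) (hT : ∀ (h : H) (u : U), T h u = ⟪h, Φ u⟫) : H →L[ℝ] C₀(U, ℝ) :=
  LinearMap.mkContinuous
    { toFun := T
      map_add' := fun a b => by ext u; simp [hT, inner_add_left]
      map_smul' := fun c a => by ext u; simp [hT, inner_smul_left] }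
    |M| fun h => by
      refine (BoundedContinuousFunction.norm_le (f := (T h).toBCF) (by positivity)).2 fun u => ?_
      calc ‖T h u‖ = ‖⟪h, Φ u⟫‖ := by rw [hT]
        _ ≤ ‖h‖ * ‖Φ u‖ := norm_inner_le_norm _ _
        _ ≤ ‖h‖ * |M| := by gcongr; exact (hM u).trans (le_abs_self M)
        _ = |M| * ‖h‖ := mul_comm _ _

variable [MeasurableSpace U]

lemma ZeroAtInftyContinuousMap.integrable_of_isFiniteMeasure [OpensMeasurableSpace U]
    (f : C₀(U, ℝ)) (ν : Measure U) [IsFiniteMeasure ν] : Integrable f ν :=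
  BoundedContinuousFunction.integrable ν f.toBCF

lemma norm_integral_zeroAtInfty_le (f : C₀(U, ℝ)) (ν : Measure U) [IsProbabilityMeasure ν] :
    ‖∫ u, f u ∂ν‖ ≤ ‖f‖ := by
  simpa using norm_integral_le_of_norm_le_const (μ := ν) (ae_of_all _ f.norm_apply_le)

lemma integrable_integral_kernel_zeroAtInfty [PolishSpace U] [BorelSpace U]
    {μ : Measure Y} (κ : Kernel Y U) [IsMarkovKernel κ] {f : Y → C₀(U, ℝ)}
    (hf : Integrable f μ) : Integrable (fun y => ∫ u, f y u ∂(κ y)) μ := by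
  refine hf.norm.mono' ?_ (ae_of_all _ fun y => norm_integral_zeroAtInfty_le (f y) (κ y))
  obtain ⟨g, hg, hfg⟩ := hf.aestronglyMeasurable
  have hg' : StronglyMeasurable fun p : Y × U => g p.1 p.2 :=
    ZeroAtInftyContinuousMap.continuous_uncurry_apply.comp_stronglyMeasurable
      ((hg.comp_measurable measurable_fst).prodMk measurable_snd.stronglyMeasurable)
  refine ⟨_, hg'.integral_kernel_prod_right' (κ := κ), ?_⟩
  filter_upwards [hfg] with y hy
  simp [hy]

lemma dist_integral_integral_kernel_zeroAtInfty_le [PolishSpace U] [BorelSpace U]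
    {μ : Measure Y} (κ : Kernel Y U) [IsMarkovKernel κ] {f g : Y → C₀(U, ℝ)}
    (hf : Integrable f μ) (hg : Integrable g μ) :
    dist (∫ y, ∫ u, f y u ∂(κ y) ∂μ) (∫ y, ∫ u, g y u ∂(κ y) ∂μ) ≤ ∫ y, ‖f y - g y‖ ∂μ := by
  rw [dist_eq_norm, ← integral_sub (integrable_integral_kernel_zeroAtInfty κ hf)
    (integrable_integral_kernel_zeroAtInfty κ hg)]
  refine norm_integral_le_of_norm_le (hf.sub hg).norm (ae_of_all _ fun y => ?_)
  rw [← integral_sub ((f y).integrable_of_isFiniteMeasure _)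
    ((g y).integrable_of_isFiniteMeasure _)]
  exact norm_integral_zeroAtInfty_le (f y - g y) (κ y)

/-- Composition with a continuous linear map of dense range has dense range on `L¹`. -/
lemma exists_integrable_integral_norm_sub_comp_le {E F : Type*} [NormedAddCommGroup E]
    [NormedSpace ℝ E] [NormedAddCommGroup F] [NormedSpace ℝ F] {μ : Measure Y}
    (L : E →L[ℝ] F) (hL : DenseRange L) {f : Y → F} (hf : Integrable f μ)
    {ε : ℝ} (hε : 0 < ε) :
    ∃ g : Y → E, Integrable g μ ∧ ∫ y, ‖f y - L (g y)‖ ∂μ ≤ ε := by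
  obtain ⟨_, hfg, g, hg, rfl⟩ := MemLp.induction_dense (μ := μ) (p := 1) ENNReal.one_ne_top
    (P := fun k => ∃ g : Y → E, Integrable g μ ∧ k = fun y => L (g y))
    (fun c s hs hμs δ hδ => by
      have hcont : Continuous fun x : F => ‖x - c‖ₑ * μ s :=
        (ENNReal.continuous_mul_const hμs.ne).comp (continuous_id.sub continuous_const).enorm
      obtain ⟨h, hh⟩ := hL.exists_mem_open (isOpen_Iio.preimage hcont)
        ⟨c, by simpa [pos_iff_ne_zero] using hδ⟩
      refine ⟨_, ?_, s.indicator fun _ => h,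
        (integrable_indicator_iff hs).2 (integrableOn_const hμs.ne), rfl⟩
      have heq : (fun y => L (s.indicator (fun _ => h) y)) - s.indicator (fun _ => c)
          = s.indicator fun _ => L h - c := by
        ext1 y; by_cases hy : y ∈ s <;> simp [hy]
      rw [heq]
      refine (eLpNorm_indicator_const_le _ _).trans ?_
      simpa using hh.le)
    (by
      rintro _ _ ⟨g, hg, rfl⟩ ⟨k, hk, rfl⟩
      exact ⟨g + k, hg.add hk, by ext1 y; simp⟩)
    (by
      rintro _ ⟨g, hg, rfl⟩
      exact (L.integrable_comp hg).aestronglyMeasurable)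
    (memLp_one_iff_integrable.2 hf) (ε := ENNReal.ofReal ε) (by simpa using hε)
  refine ⟨g, hg, ?_⟩
  rw [eLpNorm_one_eq_lintegral_enorm] at hfg
  have hmeas : AEStronglyMeasurable (fun y => f y - L (g y)) μ :=
    (hf.sub (L.integrable_comp hg)).aestronglyMeasurable
  rw [integral_norm_eq_lintegral_enorm hmeas]
  exact ENNReal.toReal_le_of_le_ofReal hε.le hfg

lemma integral_featureCLM_eq_inner [PolishSpace U] [BorelSpace U] [CompleteSpace H]
    (Φ : U → H) (hΦ : Continuous Φ) (M : ℝ) (hM : ∀ u, ‖Φ u‖ ≤ M)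
    (T : H → C₀(U, ℝ)) (hT : ∀ (h : H) (u : U), T h u = ⟪h, Φ u⟫)
    (ν : Measure U) [IsFiniteMeasure ν] (h : H) :
    ∫ u, featureCLM Φ M hM T hT h u ∂ν = ⟪∫ u, Φ u ∂ν, h⟫ := by
  have hΦi : Integrable Φ ν := .of_bound hΦ.aestronglyMeasurable M (ae_of_all _ hM)
  rw [real_inner_comm, ← integral_inner hΦi]
  exact integral_congr_ae (ae_of_all _ fun u => hT h u)

end KernelMeanEmbedding

/-- For stochastic kernels `γₙ, γ` from `Y` to `U`, convergence in the weak kernel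
mean embedding topology (testing the embeddings `I(γₙ(y)) = ∫ Φ dγₙ(y)` against all
`g ∈ L¹(μ, H)`) is equivalent to convergence in the `w*`-topology (testing against all
`f ∈ L¹(μ, C₀(U))`). Here `H` is a separable real Hilbert space, `Φ : U → H` is a bounded
continuous feature map such that `u ↦ ⟪h, Φ u⟫` is in `C₀(U)` for all `h` (witnessed by `T`)
and these functions are dense in `C₀(U)`. -/
theorem stmt1
    {Y U : Type*} [TopologicalSpace Y] [PolishSpace Y] [MeasurableSpace Y] [BorelSpace Y]
    [TopologicalSpace U] [PolishSpace U] [LocallyCompactSpace U]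
    [MeasurableSpace U] [BorelSpace U]
    (μ : Measure Y) [IsProbabilityMeasure μ]
    {H : Type*} [NormedAddCommGroup H] [InnerProductSpace ℝ H] [CompleteSpace H]
    [TopologicalSpace.SeparableSpace H]
    (Φ : U → H) (hΦ_cont : Continuous Φ) (M : ℝ) (hM : ∀ u, ‖Φ u‖ ≤ M)
    (T : H → C₀(U, ℝ)) (hT : ∀ (h : H) (u : U), T h u = ⟪h, Φ u⟫)
    (hT_dense : DenseRange T)
    (γn : ℕ → Y → Measure U) (γ : Y → Measure U)
    (hγn_meas : ∀ n, ∀ D : Set U, MeasurableSet D → Measurable fun y => γn n y D)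
    (hγn_prob : ∀ n y, IsProbabilityMeasure (γn n y))
    (hγ_meas : ∀ D : Set U, MeasurableSet D → Measurable fun y => γ y D)
    (hγ_prob : ∀ y, IsProbabilityMeasure (γ y)) :
    (∀ g : Y → H, Integrable g μ →
      Tendsto (fun n => ∫ y, ⟪∫ u, Φ u ∂(γn n y), g y⟫ ∂μ) atTop
        (𝓝 (∫ y, ⟪∫ u, Φ u ∂(γ y), g y⟫ ∂μ)))
    ↔ (∀ f : Y → C₀(U, ℝ), Integrable f μ →
      Tendsto (fun n => ∫ y, ∫ u, f y u ∂(γn n y) ∂μ) atTop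
        (𝓝 (∫ y, ∫ u, f y u ∂(γ y) ∂μ))) := by
  let κ (n : ℕ) : ProbabilityTheory.Kernel Y U :=
    ⟨γn n, Measure.measurable_of_measurable_coe _ (hγn_meas n)⟩
  let κ' : ProbabilityTheory.Kernel Y U := ⟨γ, Measure.measurable_of_measurable_coe _ hγ_meas⟩
  have (n : ℕ) : ProbabilityTheory.IsMarkovKernel (κ n) := ⟨hγn_prob n⟩
  have : ProbabilityTheory.IsMarkovKernel κ' := ⟨hγ_prob⟩
  let L := featureCLM Φ M hM T hT
  have hL (ν : Measure U) [IsProbabilityMeasure ν] (h : H) :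
      ∫ u, L h u ∂ν = ⟪∫ u, Φ u ∂ν, h⟫ := integral_featureCLM_eq_inner Φ hΦ_cont M hM T hT ν h
  simp_rw [← hL]
  refine ⟨fun hw f hf => Metric.tendsto_atTop.2 fun ε hε => ?_,
    fun hw g hg => hw _ (L.integrable_comp hg)⟩
  obtain ⟨g, hg, hfg⟩ :=
    exists_integrable_integral_norm_sub_comp_le L hT_dense hf (by positivity : 0 < ε / 3)
  obtain ⟨N, hN⟩ := Metric.tendsto_atTop.1 (hw g hg) (ε / 3) (by positivity)
  refine ⟨N, fun n hn => ?_⟩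
  have h₁ := dist_integral_integral_kernel_zeroAtInfty_le (κ n) hf (L.integrable_comp hg)
  have h₂ := dist_integral_integral_kernel_zeroAtInfty_le κ' hf (L.integrable_comp hg)
  rw [dist_comm] at h₂
  have h₃ := dist_triangle4 (∫ y, ∫ u, f y u ∂(γn n y) ∂μ) (∫ y, ∫ u, L (g y) u ∂(γn n y) ∂μ)
    (∫ y, ∫ u, L (g y) u ∂(γ y) ∂μ) (∫ y, ∫ u, f y u ∂(γ y) ∂μ)
  have h₄ := hN n hn
  exact h₃.trans_lt (by
    calc _ < ε / 3 + ε / 3 + ε / 3 :=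
          add_lt_add_of_lt_of_le (add_lt_add_of_le_of_lt (h₁.trans hfg) h₄) (h₂.trans hfg)
      _ = ε := by ring)
end

section
/- Let X be a measurable space and U a locally compact Polish space. (i) If f : X → C₀(U) is strongly measurable, then the function h_f : X × U → ℝ defined by h_f(x,u) := f(x)(u) is jointly measurable, and h_f(x,·) ∈ C₀(U) for every x (h_f is a C₀-Carathéodory function). (ii) Conversely, if h : X × U → ℝ is jointly measurable and h(x,·) ∈ C₀(U) for every x ∈ X, then the map f_h : X → C₀(U) defined by f_h(x) := h(x,·) is strongly measurable. -/
open MeasureTheory Filter Topology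
open scoped ZeroAtInfty

namespace ZeroAtInftyContinuousMap

variable {U : Type*} [TopologicalSpace U]

theorem dist_le_iff {f g : C₀(U, ℝ)} {r : ℝ} (hr : 0 ≤ r) :
    dist f g ≤ r ↔ ∀ u, dist (f u) (g u) ≤ r := by
  rw [← dist_toBCF_eq_dist]
  exact BoundedContinuousFunction.dist_le hr

theorem isCompact_setOf_le_abs (f : C₀(U, ℝ)) {ε : ℝ} (hε : 0 < ε) :
    IsCompact {u | ε ≤ |f u|} := by
  obtain ⟨t, ht, hft⟩ := mem_cocompact.1
    ((zero_at_infty f).eventually (Metric.ball_mem_nhds (0 : ℝ) hε))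
  refine ht.of_isClosed_subset (isClosed_le continuous_const (map_continuous f).abs) ?_
  intro u hu
  by_contra h
  have := hft h
  simp only [dist_zero_right, Real.norm_eq_abs, Set.mem_ofPred_eq] at this hu
  linarith

/-- Soft thresholding: `f` is uniformly approximated by functions supported where `|f|` is not
small. -/
theorem exists_dist_le_eq_zero (f : C₀(U, ℝ)) {ε : ℝ} (hε : 0 < ε) :
    ∃ g : C₀(U, ℝ), dist f g ≤ ε ∧ ∀ u, |f u| < ε → g u = 0 := by
  have hcont : Continuous fun x : ℝ => x - max (-ε) (min ε x) := by fun_prop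
  have h0 : (0 : ℝ) - max (-ε) (min ε 0) = 0 := by
    rw [min_eq_right hε.le, max_eq_right (by linarith), sub_zero]
  refine ⟨⟨⟨fun u => f u - max (-ε) (min ε (f u)), hcont.comp (map_continuous f)⟩, ?_⟩, ?_, ?_⟩
  · have := (hcont.tendsto 0).comp (zero_at_infty f)
    rw [h0] at this
    exact this
  · rw [dist_le_iff hε.le]
    intro u
    change |f u - (f u - max (-ε) (min ε (f u)))| ≤ ε
    rw [sub_sub_cancel, abs_le]
    exact ⟨le_max_left _ _, max_le (by linarith) (min_le_left _ _)⟩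
  · intro u hu
    change f u - max (-ε) (min ε (f u)) = 0
    obtain ⟨h₁, h₂⟩ := abs_lt.1 hu
    rw [min_eq_right h₂.le, max_eq_right h₁.le, sub_self]

theorem isSeparable_setOf_eq_zero_off [SecondCountableTopology U] [T2Space U] {K : Set U}
    (hK : IsCompact K) : TopologicalSpace.IsSeparable {f : C₀(U, ℝ) | ∀ u ∉ K, f u = 0} := by
  have : CompactSpace K := isCompact_iff_compactSpace.1 hK
  let r : {f : C₀(U, ℝ) | ∀ u ∉ K, f u = 0} → C(K, ℝ) := fun f =>
    ⟨fun u => f.1 u, (map_continuous f.1).comp continuous_subtype_val⟩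
  have hr : Isometry r := by
    refine Isometry.of_dist_eq fun f g => eq_of_forall_ge_iff fun c => ?_
    by_cases hc : 0 ≤ c
    · rw [ContinuousMap.dist_le hc, Subtype.dist_eq, dist_le_iff hc]
      refine ⟨fun h u => ?_, fun h u => h u⟩
      by_cases hu : u ∈ K
      · exact h ⟨u, hu⟩
      · rw [f.2 u hu, g.2 u hu, dist_self]
        exact hc
    · exact ⟨fun h => absurd (dist_nonneg.trans h) hc, fun h => absurd (dist_nonneg.trans h) hc⟩
  have := hr.isEmbedding.secondCountableTopology
  exact .of_subtype _

instance instSeparableSpace [SecondCountableTopology U] [LocallyCompactSpace U] [T2Space U] :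
    TopologicalSpace.SeparableSpace C₀(U, ℝ) := by
  let K : CompactExhaustion U := default
  refine TopologicalSpace.isSeparable_univ_iff.1
    ((TopologicalSpace.IsSeparable.iUnion fun n =>
      isSeparable_setOf_eq_zero_off (K.isCompact n)).closure.mono fun f _ => ?_)
  refine Metric.mem_closure_iff.2 fun ε hε => ?_
  obtain ⟨g, hfg, hg⟩ := f.exists_dist_le_eq_zero (half_pos hε)
  obtain ⟨n, hn⟩ := K.exists_superset_of_isCompact (f.isCompact_setOf_le_abs (half_pos hε))
  exact ⟨g, Set.mem_iUnion.2 ⟨n, fun u hu => hg u (not_le.1 fun h => hu (hn h))⟩,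
    hfg.trans_lt (half_lt_self hε)⟩

end ZeroAtInftyContinuousMap

theorem measurable_of_measurableSet_preimage_closedBall {X E : Type*} [MeasurableSpace X]
    [PseudoMetricSpace E] [SecondCountableTopology E] [MeasurableSpace E] [BorelSpace E]
    {f : X → E} (hf : ∀ a r, 0 < r → MeasurableSet (f ⁻¹' Metric.closedBall a r)) :
    Measurable f := by
  refine measurable_of_isOpen fun s hs => ?_
  choose! r hr hrs using fun a (ha : a ∈ s) =>
    Metric.nhds_basis_closedBall.mem_iff.1 (hs.mem_nhds ha)
  obtain ⟨T, hT, hTs⟩ := TopologicalSpace.isOpen_iUnion_countable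
    (fun a : s => Metric.ball a.1 (r a)) fun _ => Metric.isOpen_ball
  have : s = ⋃ a ∈ T, Metric.closedBall a.1 (r a) := by
    refine subset_antisymm (fun x hx => ?_) (Set.iUnion₂_subset fun a _ => hrs a a.2)
    have hx' : x ∈ ⋃ a : s, Metric.ball a.1 (r a) :=
      Set.mem_iUnion.2 ⟨⟨x, hx⟩, Metric.mem_ball_self (hr x hx)⟩
    rw [← hTs] at hx'
    exact Set.iUnion₂_mono (fun a _ => Metric.ball_subset_closedBall) hx'
  rw [this, Set.preimage_iUnion₂]
  exact MeasurableSet.biUnion hT fun a _ => hf a (r a) (hr a a.2)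

/-- For a measurable space `X` and a locally compact Polish space `U`, a map
`f : X → C₀(U)` is strongly measurable iff the associated Carathéodory function
`(x, u) ↦ f x u` is jointly measurable. (Part (i) is the forward direction: strong
measurability of `f` gives joint measurability of `h_f`, and `h_f(x,·) = f x ∈ C₀(U)` by
construction; part (ii) is the converse: any jointly measurable `h` with `h(x,·) ∈ C₀(U)`
for every `x` is of the form `h = h_f` for `f = f_h : X → C₀(U)`, and `f_h` is strongly
measurable.) -/
theorem stmt4
    {X U : Type*} [MeasurableSpace X]
    [TopologicalSpace U] [PolishSpace U] [LocallyCompactSpace U]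
    [MeasurableSpace U] [BorelSpace U]
    (f : X → C₀(U, ℝ)) :
    MeasureTheory.StronglyMeasurable f ↔ Measurable fun p : X × U => f p.1 p.2 := by
  constructor
  · intro hf
    have heval : Continuous fun q : C₀(U, ℝ) × U => q.1 q.2 :=
      (continuous_eval (F := BoundedContinuousFunction U ℝ)).comp
        ((ZeroAtInftyContinuousMap.isometry_toBCF.continuous.comp continuous_fst).prodMk
          continuous_snd)
    exact (heval.comp_stronglyMeasurable ((hf.comp_measurable measurable_fst).prodMk
      measurable_snd.stronglyMeasurable)).measurable
  · intro hf
    borelize C₀(U, ℝ)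
    have : SecondCountableTopology C₀(U, ℝ) :=
      UniformSpace.secondCountable_of_separable _
    refine (measurable_of_measurableSet_preimage_closedBall fun g r hr => ?_).stronglyMeasurable
    obtain ⟨D, hDc, hD⟩ := TopologicalSpace.exists_countable_dense U
    have : f ⁻¹' Metric.closedBall g r = ⋂ u ∈ D, {x | dist (f x u) (g u) ≤ r} := by
      ext x
      simp only [Set.mem_preimage, Metric.mem_closedBall, Set.mem_iInter, Set.mem_ofPred_eq,
        ZeroAtInftyContinuousMap.dist_le_iff hr.le]
      refine ⟨fun h u _ => h u, fun h u => ?_⟩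
      exact (isClosed_le ((map_continuous (f x)).dist (map_continuous g))
        continuous_const).closure_subset_iff.2 h (hD u)
    rw [this]
    refine MeasurableSet.biInter hDc fun u _ => ?_
    have hu : Measurable fun x => f x u := hf.comp measurable_prodMk_right
    exact measurableSet_le (hu.dist measurable_const) measurable_const
end

section
/- Suppose U is compact. Let γ_n (n ∈ ℕ) be stochastic kernels from Y to U and let γ : Y → M(U) be a weakly* measurable map (y ↦ ∫ g dγ(y) measurable for each g ∈ C(U)) such that γ(y) is a (nonnegative) sub-probability measure, γ(y)(U) ≤ 1, for every y. If ∫_Y ∫_U f(y)(u) γ_n(y)(du) dμ(y) → ∫_Y ∫_U f(y)(u) γ(y)(du) dμ(y) for every f ∈ L¹(μ, C(U)), then γ(y)(U) = 1 for μ-almost every y; in particular, when U is compact the set of stochastic kernels is sequentially closed in the w*-topology. -/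
open MeasureTheory Filter Topology

/-- Suppose `U` is compact. If stochastic kernels `γₙ` converge in the
`w*`-topology (testing against all `f ∈ L¹(μ, C(U))`) to a weakly* measurable sub-probability
valued map `γ`, then `γ(y)` is a probability measure for `μ`-a.e. `y`; in particular for
compact `U` the set of stochastic kernels is sequentially closed in the `w*`-topology. -/
theorem stmt6
    {Y U : Type*} [TopologicalSpace Y] [PolishSpace Y] [MeasurableSpace Y] [BorelSpace Y]
    [TopologicalSpace U] [PolishSpace U] [CompactSpace U]
    [MeasurableSpace U] [BorelSpace U]
    (μ : Measure Y) [IsProbabilityMeasure μ]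
    (γn : ℕ → Y → Measure U)
    (hγn_meas : ∀ n, ∀ D : Set U, MeasurableSet D → Measurable fun y => γn n y D)
    (hγn_prob : ∀ n y, IsProbabilityMeasure (γn n y))
    (γ : Y → Measure U)
    (hγ_wm : ∀ g : C(U, ℝ), Measurable fun y => ∫ u, g u ∂(γ y))
    (hγ_sub : ∀ y, γ y Set.univ ≤ 1)
    (hconv : ∀ f : Y → C(U, ℝ), Integrable f μ →
      Tendsto (fun n => ∫ y, ∫ u, f y u ∂(γn n y) ∂μ) atTop
        (𝓝 (∫ y, ∫ u, f y u ∂(γ y) ∂μ))) :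
    ∀ᵐ y ∂μ, γ y Set.univ = 1 := by
  have hlim := hconv (fun _ => 1) (integrable_const _)
  have hmeas := hγ_wm 1
  simp only [ContinuousMap.one_apply, integral_const, smul_eq_mul, mul_one, probReal_univ]
    at hlim hmeas
  have hint_eq : ∫ y, (γ y).real Set.univ ∂μ = 1 := tendsto_nhds_unique hlim tendsto_const_nhds
  have hle : ∀ y, (γ y).real Set.univ ≤ 1 := fun y =>
    ENNReal.toReal_le_of_le_ofReal zero_le_one (by simpa using hγ_sub y)
  have hint : Integrable (fun y => (γ y).real Set.univ) μ :=
    Integrable.of_bound hmeas.aestronglyMeasurable 1 (Eventually.of_forall fun y => by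
      rw [Real.norm_of_nonneg measureReal_nonneg]; exact hle y)
  have hae : (fun y => (γ y).real Set.univ) =ᵐ[μ] fun _ => 1 :=
    (integral_eq_iff_of_ae_le hint (integrable_const _) (Eventually.of_forall hle)).mp
      (by simpa using hint_eq)
  filter_upwards [hae] with y hy
  exact (ENNReal.toReal_eq_one_iff _).mp hy
end

section
/- The set H_{P≤1} := { I(ν) : ν a Borel sub-probability measure on U (a nonnegative Borel measure with ν(U) ≤ 1) } is a closed subset of the Hilbert space H in the norm topology. -/
open MeasureTheory Filter Topology
open scoped ZeroAtInfty RealInnerProductSpace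

namespace ZeroAtInftyContinuousMap

variable {U : Type*} [TopologicalSpace U] [T2Space U]

/-- The continuous extension by zero of a function vanishing at infinity to the one-point
compactification. -/
noncomputable def toOnePoint (f : C₀(U, ℝ)) : C(OnePoint U, ℝ) :=
  OnePoint.continuousMapMk f 0 <| by
    rw [coclosedCompact_eq_cocompact]
    exact f.zero_at_infty'

@[simp]
lemma toOnePoint_coe (f : C₀(U, ℝ)) (u : U) : f.toOnePoint (u : OnePoint U) = f u := rfl

@[simp]
lemma toOnePoint_infty (f : C₀(U, ℝ)) : f.toOnePoint OnePoint.infty = 0 := rfl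

variable [MeasurableSpace U] [BorelSpace U] [MeasurableSpace (OnePoint U)]
  [BorelSpace (OnePoint U)]

lemma integral_toOnePoint_map (f : C₀(U, ℝ)) (ν : Measure U) :
    ∫ z, f.toOnePoint z ∂(ν.map ((↑) : U → OnePoint U)) = ∫ u, f u ∂ν :=
  OnePoint.isOpenEmbedding_coe.measurableEmbedding.integral_map _

lemma integral_toOnePoint (f : C₀(U, ℝ)) (μ : Measure (OnePoint U)) :
    ∫ z, f.toOnePoint z ∂μ = ∫ u, f u ∂(μ.comap ((↑) : U → OnePoint U)) := by
  have hemb := (OnePoint.isOpenEmbedding_coe (X := U)).measurableEmbedding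
  rw [← integral_toOnePoint_map, hemb.map_comap]
  refine (setIntegral_eq_integral_of_forall_compl_eq_zero fun z hz ↦ ?_).symm
  rw [OnePoint.notMem_range_coe_iff.mp hz, toOnePoint_infty]

end ZeroAtInftyContinuousMap

/-- The set `H_{P≤1}` of kernel mean embeddings `I(ν) = ∫ Φ dν` of Borel
sub-probability measures `ν` on `U` (nonnegative Borel measures with `ν(U) ≤ 1`) is a closed
subset of the Hilbert space `H` in the norm topology. -/
theorem stmt7
    {U : Type*} [TopologicalSpace U] [PolishSpace U] [LocallyCompactSpace U]
    [MeasurableSpace U] [BorelSpace U]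
    {H : Type*} [NormedAddCommGroup H] [InnerProductSpace ℝ H] [CompleteSpace H]
    [TopologicalSpace.SeparableSpace H]
    (Φ : U → H) (hΦ_cont : Continuous Φ) (M : ℝ) (hM : ∀ u, ‖Φ u‖ ≤ M)
    (T : H → C₀(U, ℝ)) (hT : ∀ (h : H) (u : U), T h u = ⟪h, Φ u⟫)
    (hT_dense : DenseRange T) :
    IsClosed {x : H | ∃ ν : Measure U, ν Set.univ ≤ 1 ∧ x = ∫ u, Φ u ∂ν} := by
  borelize (OnePoint U)
  have hemb := (OnePoint.isOpenEmbedding_coe (X := U)).measurableEmbedding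
  have inner_mean (ν : Measure U) (hν : ν Set.univ ≤ 1) (h : H) :
      ⟪h, ∫ u, Φ u ∂ν⟫ = ∫ u, T h u ∂ν := by
    have : IsFiniteMeasure ν := ⟨hν.trans_lt ENNReal.one_lt_top⟩
    have hint : Integrable Φ ν := .of_bound hΦ_cont.aestronglyMeasurable M (.of_forall hM)
    simp_rw [hT]
    exact (integral_inner hint h).symm
  let K : Set (FiniteMeasure (OnePoint U)) := {μ | μ.mass ≤ 1}
  have : CompactSpace K := isCompact_iff_compactSpace.mp
    (isCompact_setOfPred_finiteMeasure_le_of_compactSpace (OnePoint U) 1)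
  let C : Set (H × K) :=
    {p | ∀ h, ⟪h, p.1⟫ = ∫ z, (T h).toOnePoint z ∂(p.2.1 : Measure (OnePoint U))}
  have hC : IsClosed C := by
    simp only [C, Set.ofPred_forall]
    refine isClosed_iInter fun h ↦ isClosed_eq (by fun_prop) ?_
    exact (FiniteMeasure.continuous_integral_boundedContinuousFunction
      (BoundedContinuousFunction.mkOfCompact (T h).toOnePoint)).comp
        (continuous_subtype_val.comp continuous_snd)
  have mass_le (μ : FiniteMeasure (OnePoint U)) :
      μ.mass ≤ 1 ↔ (μ : Measure (OnePoint U)) Set.univ ≤ 1 := by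
    rw [← FiniteMeasure.ennreal_mass]; norm_cast
  convert isClosedMap_fst_of_compactSpace C hC using 1
  ext x
  constructor
  · rintro ⟨ν, hν, rfl⟩
    have : IsFiniteMeasure ν := ⟨hν.trans_lt ENNReal.one_lt_top⟩
    refine ⟨(_, ⟨⟨ν.map ((↑) : U → OnePoint U), inferInstance⟩, ?_⟩), fun h ↦ ?_, rfl⟩
    · refine (mass_le _).mpr ?_
      simpa [FiniteMeasure.toMeasure_mk, hemb.map_apply] using hν
    · exact (inner_mean ν hν h).trans ((T h).integral_toOnePoint_map ν).symm
  · rintro ⟨⟨x, μ, hμ⟩, hx, rfl⟩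
    have hν : (μ : Measure (OnePoint U)).comap ((↑) : U → OnePoint U) Set.univ ≤ 1 := by
      rw [hemb.comap_apply]
      exact (measure_mono (Set.subset_univ _)).trans ((mass_le μ).mp hμ)
    refine ⟨_, hν, ext_inner_left ℝ fun h ↦ ?_⟩
    rw [inner_mean _ hν, ← ZeroAtInftyContinuousMap.integral_toOnePoint]
    exact hx h
end

section
/- Suppose U is not compact. Then there exists a sequence (ν_n) of Borel probability measures on U such that ⟪I(ν_n), h⟫ → 0 for every h ∈ H. Consequently, the constant stochastic kernels γ_n(y) := ν_n satisfy ∫_Y ⟪I(γ_n(y)), g(y)⟫ dμ(y) → 0 for every g ∈ L¹(μ, H), while the zero vector of H is not equal to I(ν) for any Borel probability measure ν on U; hence the set of kernel mean embeddings of stochastic kernels is not sequentially closed in the weak kernel mean embedding topology. -/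
open MeasureTheory Filter Topology
open scoped ZeroAtInfty RealInnerProductSpace

/-- A probability measure on a σ-compact, locally compact Hausdorff space is not annihilated by
all functions vanishing at infinity. -/
theorem exists_zeroAtInfty_integral_pos {U : Type*} [TopologicalSpace U] [T2Space U]
    [LocallyCompactSpace U] [SigmaCompactSpace U] [MeasurableSpace U] [BorelSpace U]
    (ρ : Measure U) [IsProbabilityMeasure ρ] : ∃ f : C₀(U, ℝ), 0 < ∫ u, f u ∂ρ := by
  obtain ⟨n, hn⟩ : ∃ n, ρ (compactCovering U n) ≠ 0 := by
    by_contra! h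
    have := measure_iUnion_null h
    rw [iUnion_compactCovering] at this
    simp at this
  have hK := isCompact_compactCovering U n
  obtain ⟨f, hf1, -, hfc, hf01⟩ :=
    exists_continuous_one_zero_of_isCompact hK isClosed_empty (Set.disjoint_empty _)
  refine ⟨⟨f, hfc.is_zero_at_infty⟩, ?_⟩
  have hfi : Integrable f ρ := f.continuous.integrable_of_hasCompactSupport hfc
  change 0 < ∫ u, f u ∂ρ
  rw [integral_pos_iff_support_of_nonneg (fun u => (hf01 u).1) hfi]
  refine (pos_iff_ne_zero.2 hn).trans_le (measure_mono fun u hu => ?_)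
  simp [hf1 hu]

/-- A bounded feature map whose scalar functions are dense in `C₀(U, ℝ)` sends no probability
measure to zero. -/
theorem integral_ne_zero_of_denseRange_zeroAtInfty {U : Type*} [TopologicalSpace U] [PolishSpace U]
    [LocallyCompactSpace U] [MeasurableSpace U] [BorelSpace U]
    {H : Type*} [NormedAddCommGroup H] [InnerProductSpace ℝ H] [CompleteSpace H]
    {Φ : U → H} (hΦ_cont : Continuous Φ) {M : ℝ} (hM : ∀ u, ‖Φ u‖ ≤ M)
    {T : H → C₀(U, ℝ)} (hT : ∀ (h : H) (u : U), T h u = ⟪h, Φ u⟫)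
    (hT_dense : DenseRange T) (ρ : Measure U) [IsProbabilityMeasure ρ] :
    ∫ u, Φ u ∂ρ ≠ 0 := by
  intro h0
  have hΦ : Integrable Φ ρ :=
    .of_bound hΦ_cont.aestronglyMeasurable M (ae_of_all _ hM)
  have hT0 (h : H) : ∫ u, T h u ∂ρ = 0 := by
    simp_rw [hT, integral_inner hΦ, h0, inner_zero_right]
  obtain ⟨f, hf⟩ := exists_zeroAtInfty_integral_pos ρ
  have hint (k : C₀(U, ℝ)) : Integrable k ρ := k.toBCF.integrable ρ
  obtain ⟨h, hh⟩ := hT_dense.exists_dist_lt f hf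
  have hle : ‖∫ u, (f u - T h u) ∂ρ‖ ≤ dist f (T h) * ρ.real Set.univ := by
    refine norm_integral_le_of_norm_le_const (ae_of_all _ fun u => ?_)
    rw [← dist_eq_norm, ← ZeroAtInftyContinuousMap.dist_toBCF_eq_dist]
    exact BoundedContinuousFunction.dist_coe_le_dist (f := f.toBCF) (g := (T h).toBCF) u
  rw [integral_sub (hint f) (hint (T h)), hT0, sub_zero, Real.norm_of_nonneg hf.le,
    probReal_univ, mul_one] at hle
  exact hle.not_gt hh

/-- If `U` is not compact, there is a sequence `νₙ` of Borel probability measures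
on `U` with `⟪I(νₙ), h⟫ → 0` for every `h ∈ H`; consequently the constant kernels
`γₙ(y) := νₙ` satisfy `∫_Y ⟪I(νₙ), g(y)⟫ dμ → 0` for every `g ∈ L¹(μ, H)`, while the zero
vector of `H` is not the kernel mean embedding of any probability measure; hence the set of
kernel mean embeddings of stochastic kernels is not sequentially closed in the weak kernel
mean embedding topology. -/
theorem stmt9
    {Y U : Type*} [TopologicalSpace Y] [PolishSpace Y] [MeasurableSpace Y] [BorelSpace Y]
    [TopologicalSpace U] [PolishSpace U] [LocallyCompactSpace U]
    [MeasurableSpace U] [BorelSpace U]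
    (μ : Measure Y) [IsProbabilityMeasure μ]
    {H : Type*} [NormedAddCommGroup H] [InnerProductSpace ℝ H] [CompleteSpace H]
    [TopologicalSpace.SeparableSpace H]
    (Φ : U → H) (hΦ_cont : Continuous Φ) (M : ℝ) (hM : ∀ u, ‖Φ u‖ ≤ M)
    (T : H → C₀(U, ℝ)) (hT : ∀ (h : H) (u : U), T h u = ⟪h, Φ u⟫)
    (hT_dense : DenseRange T)
    (hU : ¬ CompactSpace U) :
    ∃ ν : ℕ → Measure U, (∀ n, IsProbabilityMeasure (ν n)) ∧
      (∀ h : H, Tendsto (fun n => ⟪∫ u, Φ u ∂(ν n), h⟫) atTop (𝓝 0)) ∧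
      (∀ g : Y → H, Integrable g μ →
        Tendsto (fun n => ∫ y, ⟪∫ u, Φ u ∂(ν n), g y⟫ ∂μ) atTop (𝓝 0)) ∧
      (∀ ρ : Measure U, IsProbabilityMeasure ρ → (∫ u, Φ u ∂ρ) ≠ 0) := by
  have : NoncompactSpace U := not_compactSpace_iff.1 hU
  let K : CompactExhaustion U := default
  choose u hu_notMem using fun n =>
    (Set.ne_univ_iff_exists_notMem _).1 (K.isCompact n).ne_univ
  have hu : Tendsto u atTop (cocompact U) := by
    refine (hasBasis_cocompact.tendsto_right_iff).2 fun s hs => ?_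
    obtain ⟨m, hm⟩ := K.exists_superset_of_isCompact hs
    filter_upwards [eventually_ge_atTop m] with n hn hmem
    exact hu_notMem n (K.subset hn (hm hmem))
  have hweak (h : H) : Tendsto (fun n => ⟪Φ (u n), h⟫) atTop (𝓝 0) := by
    simpa only [Function.comp_def, hT, real_inner_comm h] using (zero_at_infty (T h)).comp hu
  have hdirac (n : ℕ) : ∫ v, Φ v ∂(Measure.dirac (u n)) = Φ (u n) := integral_dirac _ _
  refine ⟨fun n => Measure.dirac (u n), fun n => inferInstance, ?_, ?_, fun ρ _ =>
    integral_ne_zero_of_denseRange_zeroAtInfty hΦ_cont hM hT hT_dense ρ⟩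
  · simpa only [hdirac] using hweak
  · intro g hg
    simp only [hdirac]
    rw [← integral_zero Y ℝ (μ := μ)]
    refine tendsto_integral_of_dominated_convergence (fun y => M * ‖g y‖)
      (fun n => aestronglyMeasurable_const.inner hg.1) (hg.norm.const_mul M)
      (fun n => ae_of_all _ fun y => ?_) (ae_of_all _ fun y => hweak (g y))
    exact (norm_inner_le_norm _ _).trans (by gcongr; exact hM _)
end

section
/- Let γ : Y → P(U) be a map assigning to each y ∈ Y a Borel probability measure γ(y) on U. Then γ is a stochastic kernel (y ↦ γ(y)(D) measurable for every Borel D ⊆ U) if and only if the map y ↦ I(γ(y)) = ∫_U Φ(u) γ(y)(du) from Y to H is strongly measurable. (The set of kernel mean embeddings of stochastic kernels coincides with the set of strongly measurable H-valued functions on Y whose values are embeddings of probability measures.) -/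
open MeasureTheory Filter Topology
open scoped ZeroAtInfty RealInnerProductSpace

theorem measurable_integral_of_tendsto_zeroAtInfty {Y U : Type*} [MeasurableSpace Y]
    [TopologicalSpace U] [MeasurableSpace U] [OpensMeasurableSpace U]
    {γ : Y → Measure U} [∀ y, IsFiniteMeasure (γ y)] {F : ℕ → C₀(U, ℝ)} {f : C₀(U, ℝ)}
    (hF : ∀ n, Measurable fun y => ∫ u, F n u ∂(γ y)) (hf : Tendsto F atTop (𝓝 f)) :
    Measurable fun y => ∫ u, f u ∂(γ y) := by
  refine measurable_of_tendsto_metrizable hF (tendsto_pi_nhds.2 fun y => ?_)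
  have hint (g : C₀(U, ℝ)) : Integrable (fun u => g u) (γ y) := g.toBCF.integrable (γ y)
  have hnorm : Tendsto (fun n => ‖F n - f‖ * (γ y).real Set.univ) atTop (𝓝 0) := by
    simpa using (tendsto_iff_norm_sub_tendsto_zero.1 hf).mul_const ((γ y).real Set.univ)
  refine tendsto_iff_norm_sub_tendsto_zero.2
    (squeeze_zero (fun _ => norm_nonneg _) (fun n => ?_) hnorm)
  rw [← integral_sub (hint _) (hint _)]
  exact norm_integral_le_of_norm_le_const
    (.of_forall fun u => (F n - f).toBCF.norm_coe_le_norm u)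

theorem measurable_measure_of_measurable_integral_zeroAtInfty {Y U : Type*} [MeasurableSpace Y]
    [TopologicalSpace U] [PolishSpace U] [LocallyCompactSpace U]
    [MeasurableSpace U] [BorelSpace U]
    {γ : Y → Measure U} [∀ y, IsProbabilityMeasure (γ y)]
    (h : ∀ f : C₀(U, ℝ), Measurable fun y => ∫ u, f u ∂(γ y)) :
    Measurable γ := by
  let := TopologicalSpace.upgradeIsCompletelyMetrizable U
  have hcompact (K : Set U) (hK : IsCompact K) : Measurable fun y => γ y K := by
    obtain ⟨f, hfK, -, hf_supp, hf01⟩ := exists_continuous_one_zero_of_isCompact_of_isGδ hK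
      hK.isClosed.isGδ isClosed_empty (Set.disjoint_empty K)
    have hpow (n : ℕ) : Measurable fun y => ∫ u, f u ^ (n + 1) ∂(γ y) := by
      have hs : HasCompactSupport fun u => f u ^ (n + 1) :=
        hf_supp.comp_left (g := fun x : ℝ => x ^ (n + 1)) (by simp)
      exact h ⟨⟨fun u => f u ^ (n + 1), by fun_prop⟩, hs.is_zero_at_infty⟩
    have hreal : Measurable fun y => (γ y).real K := by
      refine measurable_of_tendsto_metrizable hpow (tendsto_pi_nhds.2 fun y => ?_)
      rw [← integral_indicator_one hK.measurableSet]
      refine tendsto_integral_of_dominated_convergence (fun _ => 1)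
        (fun n => (f.continuous.pow (n + 1)).aestronglyMeasurable) (integrable_const 1)
        (fun n => .of_forall fun u => ?_) (.of_forall fun u => ?_)
      · rw [Real.norm_of_nonneg (pow_nonneg (hf01 u).1 _)]
        exact pow_le_one₀ (hf01 u).1 (hf01 u).2
      · by_cases hu : u ∈ K
        · have : f u = 1 := by rwa [hfK] at hu
          simp [hu, this]
        · have : f u < 1 := lt_of_le_of_ne (hf01 u).2 fun h1 => hu (by rw [hfK]; exact h1)
          simpa [hu, Function.comp_def] using
            (tendsto_pow_atTop_nhds_zero_of_lt_one (hf01 u).1 this).comp (tendsto_add_atTop_nat 1)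
    simpa using hreal.ennreal_ofReal
  refine .measure_of_isPiSystem_of_isProbabilityMeasure
    (S := {s : Set U | IsClosed s})
    (by rw [BorelSpace.measurable_eq (α := U), borel_eq_generateFrom_isClosed])
    isPiSystem_isClosed fun D hD => ?_
  refine measurable_of_tendsto_metrizable
    (fun n => hcompact (D ∩ compactCovering U n) ((isCompact_compactCovering U n).inter_left hD))
    (tendsto_pi_nhds.2 fun y => ?_)
  have := tendsto_measure_iUnion_atTop (μ := γ y) (s := fun n => D ∩ compactCovering U n)
    fun m n hmn => Set.inter_subset_inter_right D (compactCovering_subset U hmn)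
  rwa [← Set.inter_iUnion, iUnion_compactCovering, Set.inter_univ] at this

/-- A probability-measure valued map `γ : Y → P(U)` is a stochastic kernel
(`y ↦ γ(y)(D)` measurable for every Borel `D`) iff the map `y ↦ I(γ(y)) = ∫ Φ dγ(y)` from
`Y` to `H` is strongly measurable. -/
theorem stmt13
    {Y U : Type*} [TopologicalSpace Y] [PolishSpace Y] [MeasurableSpace Y] [BorelSpace Y]
    [TopologicalSpace U] [PolishSpace U] [LocallyCompactSpace U]
    [MeasurableSpace U] [BorelSpace U]
    {H : Type*} [NormedAddCommGroup H] [InnerProductSpace ℝ H] [CompleteSpace H]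
    [TopologicalSpace.SeparableSpace H]
    (Φ : U → H) (hΦ_cont : Continuous Φ) (M : ℝ) (hM : ∀ u, ‖Φ u‖ ≤ M)
    (T : H → C₀(U, ℝ)) (hT : ∀ (h : H) (u : U), T h u = ⟪h, Φ u⟫)
    (hT_dense : DenseRange T)
    (γ : Y → Measure U) (hγ_prob : ∀ y, IsProbabilityMeasure (γ y)) :
    (∀ D : Set U, MeasurableSet D → Measurable fun y => γ y D)
    ↔ StronglyMeasurable fun y => ∫ u, Φ u ∂(γ y) := by
  rw [← Measure.measurable_measure]
  have hΦ : StronglyMeasurable Φ := hΦ_cont.stronglyMeasurable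
  refine ⟨fun hγ => ?_, fun hI => ?_⟩
  · let κ : ProbabilityTheory.Kernel Y U := ⟨γ, hγ⟩
    exact hΦ.integral_kernel (κ := κ)
  · refine measurable_measure_of_measurable_integral_zeroAtInfty fun f => ?_
    obtain ⟨F, hF_mem, hF⟩ := mem_closure_iff_seq_limit.1 (hT_dense f)
    refine measurable_integral_of_tendsto_zeroAtInfty (fun n => ?_) hF
    obtain ⟨h, hh⟩ := hF_mem n
    have hint (y : Y) : Integrable Φ (γ y) :=
      .of_bound hΦ.aestronglyMeasurable M (.of_forall hM)
    simp_rw [← hh, hT, integral_inner (hint _)]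
    exact (stronglyMeasurable_const.inner hI).measurable
end

section
/- Assume additionally that Y is a locally compact Polish space. Let ξ be a Borel probability measure on U, let f_n : U × Y → [0,∞) (n ∈ ℕ) be a uniformly bounded family (sup_n sup_{(u,y)} f_n(u,y) < ∞) that is equicontinuous on U × Y, and let f : U × Y → [0,∞) be jointly measurable, such that for every y ∈ Y the measures γ_n(y)(du) := f_n(u,y) ξ(du) and γ(y)(du) := f(u,y) ξ(du) are Borel probability measures and γ_n, γ are stochastic kernels. If γ_n converges to γ in the weak kernel mean embedding topology, then for every q ∈ [1,∞), ∫_Y ‖I(γ_n(y)) − I(γ(y))‖_H^q dμ(y) → 0, i.e., γ_n converges to γ in the strong kernel mean embedding topology. -/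
open MeasureTheory Filter Topology
open scoped ZeroAtInfty RealInnerProductSpace

theorem cauchySeq_of_forall_exists_dist_le {α : Type*} [PseudoMetricSpace α] {a : ℕ → α}
    (h : ∀ ε > 0, ∃ b : ℕ → α, CauchySeq b ∧ ∀ n, dist (a n) (b n) ≤ ε) : CauchySeq a := by
  rw [Metric.cauchySeq_iff']
  intro ε hε
  obtain ⟨b, hb, hab⟩ := h (ε / 4) (by positivity)
  obtain ⟨N, hN⟩ := Metric.cauchySeq_iff'.1 hb (ε / 4) (by positivity)
  refine ⟨N, fun n hn => ?_⟩
  have h1 := dist_triangle4 (a n) (b n) (b N) (a N)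
  have h2 := hN n hn
  have h3 := hab n
  have h4 := hab N
  rw [dist_comm] at h4
  linarith

theorem integral_withDensity_ofReal {X E : Type*} [MeasurableSpace X] {ν : Measure X}
    [NormedAddCommGroup E] [NormedSpace ℝ E] {f : X → ℝ} (hf : Measurable f)
    (hf_nonneg : ∀ x, 0 ≤ f x) (g : X → E) :
    ∫ x, g x ∂(ν.withDensity fun x => ENNReal.ofReal (f x)) = ∫ x, f x • g x ∂ν := by
  rw [integral_withDensity_eq_integral_toReal_smul hf.ennreal_ofReal (by simp)]
  simp_rw [ENNReal.toReal_ofReal (hf_nonneg _)]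

/-- The weak Cauchy property of kernel mean embeddings transfers to test functions `1_V ⊗ φ` with
`φ` vanishing at infinity. -/
theorem cauchySeq_setIntegral_integral_of_denseRange
    {Y U H : Type*} [MeasurableSpace Y] {μ : Measure Y} [IsProbabilityMeasure μ]
    [TopologicalSpace U] [SecondCountableTopology U] [MeasurableSpace U] [BorelSpace U]
    [NormedAddCommGroup H] [InnerProductSpace ℝ H] [CompleteSpace H]
    {Φ : U → H} (hΦ_cont : Continuous Φ) {M : ℝ} (hM : ∀ u, ‖Φ u‖ ≤ M)
    {T : H → C₀(U, ℝ)} (hT : ∀ (h : H) (u : U), T h u = ⟪h, Φ u⟫) (hT_dense : DenseRange T)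
    (κ : ℕ → ProbabilityTheory.Kernel Y U) [∀ n, ProbabilityTheory.IsMarkovKernel (κ n)]
    (hκ : ∀ g : Y → H, Integrable g μ →
      CauchySeq fun n => ∫ y, ⟪∫ u, Φ u ∂(κ n y), g y⟫ ∂μ)
    (φ : C₀(U, ℝ)) {V : Set Y} (hV : MeasurableSet V) :
    CauchySeq fun n => ∫ y in V, ∫ u, φ u ∂(κ n y) ∂μ := by
  have hint : ∀ (ψ : C₀(U, ℝ)) (ν : Measure U) [IsProbabilityMeasure ν], Integrable ψ ν :=
    fun ψ ν _ => ψ.toBCF.integrable ν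
  have hbound : ∀ (ψ : C₀(U, ℝ)) n y, ‖∫ u, ψ u ∂(κ n y)‖ ≤ ‖ψ‖ := fun ψ n y => by
    simpa using norm_integral_le_of_norm_le_const (μ := κ n y)
      (Eventually.of_forall fun u => ψ.toBCF.norm_coe_le_norm u)
  have hint' : ∀ (ψ : C₀(U, ℝ)) n,
      Integrable (fun y => ∫ u, ψ u ∂(κ n y)) (μ.restrict V) := fun ψ n =>
    Integrable.of_bound
      (StronglyMeasurable.integral_kernel
        (map_continuous ψ).stronglyMeasurable).aestronglyMeasurable
      ‖ψ‖ (Eventually.of_forall (hbound ψ n))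
  refine cauchySeq_of_forall_exists_dist_le fun ε hε => ?_
  obtain ⟨h, hh⟩ := hT_dense.exists_dist_lt φ hε
  refine ⟨fun n => ∫ y in V, ∫ u, T h u ∂(κ n y) ∂μ, ?_, fun n => ?_⟩
  · convert hκ (V.indicator fun _ => h) ((integrable_const h).indicator hV) using 2 with n
    rw [← integral_indicator hV]
    refine integral_congr_ae (Eventually.of_forall fun y => ?_)
    by_cases hy : y ∈ V
    · have hΦ : Integrable Φ (κ n y) :=
        Integrable.of_bound hΦ_cont.aestronglyMeasurable M (Eventually.of_forall hM)
      simp only [Set.indicator_of_mem hy, hT]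
      rw [real_inner_comm, integral_inner hΦ]
    · simp [Set.indicator_of_notMem hy]
  · rw [dist_eq_norm, ← integral_sub (hint' _ _) (hint' _ _)]
    refine (norm_setIntegral_le_of_norm_le_const (C := ε) (measure_lt_top _ _)
      fun y _ => ?_).trans ?_
    · rw [← integral_sub (hint _ _) (hint _ _)]
      refine (hbound (φ - T h) n y).trans ?_
      rw [← dist_eq_norm]
      exact hh.le
    · exact mul_le_of_le_one_right hε.le measureReal_le_one

/-- If the integrals of an equicontinuous sequence of densities against the test functions
`φ ⊗ 1_V` are Cauchy, then so are its values at points of the support. -/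
theorem Equicontinuous.cauchySeq_of_mem_support
    {Y U : Type*} [TopologicalSpace Y] [MeasurableSpace Y] [BorelSpace Y]
    {μ : Measure Y} [IsProbabilityMeasure μ]
    [TopologicalSpace U] [SecondCountableTopology U] [LocallyCompactSpace U] [T2Space U]
    [MeasurableSpace U] [BorelSpace U] {ξ : Measure U} [IsProbabilityMeasure ξ]
    {fn : ℕ → U × Y → ℝ} {C : ℝ} (hfn_bdd : ∀ n p, ‖fn n p‖ ≤ C)
    (hfn_equicont : Equicontinuous fn)
    (hmeas : ∀ n (φ : C₀(U, ℝ)), AEStronglyMeasurable (fun y => ∫ u, fn n (u, y) * φ u ∂ξ) μ)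
    (hcauchy : ∀ (φ : C₀(U, ℝ)) (V : Set Y), MeasurableSet V →
      CauchySeq fun n => ∫ y in V, ∫ u, fn n (u, y) * φ u ∂ξ ∂μ)
    {u₀ : U} {y₀ : Y} (hu₀ : u₀ ∈ ξ.support) (hy₀ : y₀ ∈ μ.support) :
    CauchySeq fun n => fn n (u₀, y₀) := by
  refine cauchySeq_of_forall_exists_dist_le fun ε hε => ?_
  have hnear := Metric.equicontinuousAt_iff_right.1 (hfn_equicont (u₀, y₀)) ε hε
  rw [nhds_prod_eq] at hnear
  obtain ⟨A, hA, V', hV', hAV⟩ := mem_prod_iff.1 hnear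
  obtain ⟨V, hVV', hVo, hyV⟩ := mem_nhds_iff.1 hV'
  obtain ⟨A₁, hA₁A, hA₁o, huA₁⟩ := mem_nhds_iff.1 hA
  obtain ⟨φ, hφ1, hφ0, hφc, hφI⟩ := exists_continuous_one_zero_of_isCompact
    (isCompact_singleton (x := u₀)) hA₁o.isClosed_compl (by simpa using huA₁)
  let φ₀ : C₀(U, ℝ) := ⟨φ, hφc.is_zero_at_infty⟩
  have hφint : Integrable φ ξ := φ₀.toBCF.integrable ξ
  have hvpos : 0 < μ.real V :=
    ENNReal.toReal_pos ((Measure.mem_support_iff_forall _).1 hy₀ V (hVo.mem_nhds hyV)).ne'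
      (measure_ne_top _ _)
  have hcpos : 0 < ∫ u, φ u ∂ξ := by
    rw [integral_pos_iff_support_of_nonneg (fun u => (hφI u).1) hφint]
    refine (Measure.mem_support_iff_forall _).1 hu₀ _
      ((isOpen_ne.preimage φ.continuous).mem_nhds ?_)
    simp [hφ1 (Set.mem_singleton u₀)]
  set c := ∫ u, φ u ∂ξ
  have hprod : ∀ n y, Integrable (fun u => fn n (u, y) * φ u) ξ := fun n y =>
    hφint.bdd_mul (((hfn_equicont.continuous n).comp
      (Continuous.prodMk_left y)).aestronglyMeasurable)
      (Eventually.of_forall fun u => hfn_bdd n (u, y))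
  have hclose : ∀ n, ∀ y ∈ V,
      ‖fn n (u₀, y₀) * c - ∫ u, fn n (u, y) * φ u ∂ξ‖ ≤ ε * c := by
    intro n y hy
    rw [← integral_const_mul, ← integral_sub (hφint.const_mul _) (hprod n y),
      ← integral_const_mul]
    refine norm_integral_le_of_norm_le (hφint.const_mul _) (Eventually.of_forall fun u => ?_)
    rw [← sub_mul, norm_mul, Real.norm_of_nonneg (hφI u).1]
    by_cases hu : u ∈ A₁
    · refine mul_le_mul_of_nonneg_right ?_ (hφI u).1
      rw [← dist_eq_norm]
      exact (hAV (Set.mk_mem_prod (hA₁A hu) (hVV' hy)) n).le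
    · simp [hφ0 hu]
  have hinner : ∀ n, Integrable (fun y => ∫ u, fn n (u, y) * φ u ∂ξ) (μ.restrict V) := by
    refine fun n => Integrable.of_bound (hmeas n φ₀).restrict (C * c)
      (Eventually.of_forall fun y => ?_)
    rw [← integral_const_mul]
    refine norm_integral_le_of_norm_le (hφint.const_mul _) (Eventually.of_forall fun u => ?_)
    rw [norm_mul, Real.norm_of_nonneg (hφI u).1]
    exact mul_le_mul_of_nonneg_right (hfn_bdd _ _) (hφI u).1
  refine ⟨fun n => (∫ y in V, ∫ u, fn n (u, y) * φ u ∂ξ ∂μ) * (c * μ.real V)⁻¹, ?_, fun n => ?_⟩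
  · obtain ⟨l, hl⟩ := cauchySeq_tendsto_of_complete (hcauchy φ₀ V hVo.measurableSet)
    exact (hl.mul_const _).cauchySeq
  · have hle : ‖fn n (u₀, y₀) * c * μ.real V - ∫ y in V, ∫ u, fn n (u, y) * φ u ∂ξ ∂μ‖
        ≤ ε * c * μ.real V := by
      have := norm_setIntegral_le_of_norm_le_const (measure_lt_top μ V) (hclose n)
      rw [integral_sub (integrable_const _) (hinner n)] at this
      simpa [mul_comm, mul_left_comm, mul_assoc] using this
    rw [dist_eq_norm]
    have hcv : 0 < c * μ.real V := mul_pos hcpos hvpos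
    rw [← mul_le_mul_iff_left₀ hcv]
    calc _ = ‖fn n (u₀, y₀) * c * μ.real V - ∫ y in V, ∫ u, fn n (u, y) * φ u ∂ξ ∂μ‖ := by
          rw [← Real.norm_of_nonneg hcv.le, ← norm_mul, Real.norm_of_nonneg hcv.le, sub_mul,
            inv_mul_cancel_right₀ hcv.ne', mul_assoc]
      _ ≤ _ := by rw [← mul_assoc]; exact hle

/-- Almost everywhere limits and weak limits of bounded sequences agree. -/
theorem ae_eq_of_tendsto_ae_of_tendsto_integral_inner
    {Y H : Type*} [MeasurableSpace Y] {μ : Measure Y} [IsFiniteMeasure μ]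
    [NormedAddCommGroup H] [InnerProductSpace ℝ H]
    {F : ℕ → Y → H} {J G : Y → H} {M : ℝ}
    (hF_meas : ∀ n, AEStronglyMeasurable (F n) μ) (hF : ∀ n y, ‖F n y‖ ≤ M)
    (hG_meas : AEStronglyMeasurable G μ) (hG : ∀ y, ‖G y‖ ≤ M)
    (hlim : ∀ᵐ y ∂μ, Tendsto (fun n => F n y) atTop (𝓝 (J y)))
    (hweak : ∀ g : Y → H, Integrable g μ →
      Tendsto (fun n => ∫ y, ⟪F n y, g y⟫ ∂μ) atTop (𝓝 (∫ y, ⟪G y, g y⟫ ∂μ))) :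
    J =ᵐ[μ] G := by
  have hJ_meas : AEStronglyMeasurable J μ := aestronglyMeasurable_of_tendsto_ae _ hF_meas hlim
  have hJ : ∀ᵐ y ∂μ, ‖J y‖ ≤ M := by
    filter_upwards [hlim] with y hy using le_of_tendsto' hy.norm fun n => hF n y
  have hD_bdd : ∀ᵐ y ∂μ, ‖J y - G y‖ ≤ M + M := by
    filter_upwards [hJ] with y hy using (norm_sub_le _ _).trans (add_le_add hy (hG y))
  have hD : Integrable (fun y => J y - G y) μ :=
    Integrable.of_bound (hJ_meas.sub hG_meas) _ hD_bdd
  have hinner : ∀ K : Y → H, AEStronglyMeasurable K μ → (∀ᵐ y ∂μ, ‖K y‖ ≤ M) →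
      Integrable (fun y => ⟪K y, J y - G y⟫) μ := fun K hK hKM =>
    (hD.norm.const_mul M).mono' (hK.inner hD.aestronglyMeasurable) <| by
      filter_upwards [hKM] with y hy
      exact (norm_inner_le_norm _ _).trans (mul_le_mul_of_nonneg_right hy (norm_nonneg _))
  have hstrong : Tendsto (fun n => ∫ y, ⟪F n y, J y - G y⟫ ∂μ) atTop
      (𝓝 (∫ y, ⟪J y, J y - G y⟫ ∂μ)) := by
    refine tendsto_integral_of_dominated_convergence (fun y => M * ‖J y - G y‖)
      (fun n => (hF_meas n).inner hD.aestronglyMeasurable) (hD.norm.const_mul M)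
      (fun n => Eventually.of_forall fun y => (norm_inner_le_norm _ _).trans
        (mul_le_mul_of_nonneg_right (hF n y) (norm_nonneg _))) ?_
    filter_upwards [hlim] with y hy using hy.inner tendsto_const_nhds
  have heq := tendsto_nhds_unique hstrong (hweak _ hD)
  rw [← sub_eq_zero, ← integral_sub (hinner J hJ_meas hJ)
    (hinner G hG_meas (Eventually.of_forall hG))] at heq
  simp_rw [← inner_sub_left, real_inner_self_eq_norm_sq] at heq
  rw [integral_eq_zero_iff_of_nonneg (fun y => by positivity)] at heq
  · filter_upwards [heq] with y hy
    simpa [sub_eq_zero] using hy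
  · simp_rw [← real_inner_self_eq_norm_sq, inner_sub_left]
    exact (hinner J hJ_meas hJ).sub (hinner G hG_meas (Eventually.of_forall hG))

/-- Let `Y` be a locally compact Polish space with Borel probability measure
`μ`, `ξ` a Borel probability measure on `U`, and let `γₙ(y) = fₙ(·,y)ξ`, `γ(y) = f(·,y)ξ` be
stochastic kernels whose densities `fₙ` form a uniformly bounded, equicontinuous family on
`U × Y`.  If `γₙ → γ` in the weak kernel mean embedding topology, then for every
`q ∈ [1,∞)`, `∫_Y ‖I(γₙ(y)) − I(γ(y))‖^q dμ → 0`, i.e. `γₙ → γ` in the strong kernel mean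
embedding topology. -/
theorem stmt15
    {Y U : Type*} [TopologicalSpace Y] [PolishSpace Y] [LocallyCompactSpace Y]
    [MeasurableSpace Y] [BorelSpace Y]
    [TopologicalSpace U] [PolishSpace U] [LocallyCompactSpace U]
    [MeasurableSpace U] [BorelSpace U]
    (μ : Measure Y) [IsProbabilityMeasure μ]
    {H : Type*} [NormedAddCommGroup H] [InnerProductSpace ℝ H] [CompleteSpace H]
    [TopologicalSpace.SeparableSpace H]
    (Φ : U → H) (hΦ_cont : Continuous Φ) (M : ℝ) (hM : ∀ u, ‖Φ u‖ ≤ M)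
    (T : H → C₀(U, ℝ)) (hT : ∀ (h : H) (u : U), T h u = ⟪h, Φ u⟫)
    (hT_dense : DenseRange T)
    (ξ : Measure U) [IsProbabilityMeasure ξ]
    (fn : ℕ → U × Y → ℝ) (f : U × Y → ℝ)
    (hfn_nonneg : ∀ n p, 0 ≤ fn n p) (hf_nonneg : ∀ p, 0 ≤ f p)
    (hfn_bdd : ∃ C : ℝ, ∀ n p, fn n p ≤ C)
    (hfn_equicont : Equicontinuous fn)
    (hf_meas : Measurable f)
    (γn : ℕ → Y → Measure U) (γ : Y → Measure U)
    (hγn_def : ∀ n y, γn n y = ξ.withDensity fun u => ENNReal.ofReal (fn n (u, y)))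
    (hγ_def : ∀ y, γ y = ξ.withDensity fun u => ENNReal.ofReal (f (u, y)))
    (hγn_meas : ∀ n, ∀ D : Set U, MeasurableSet D → Measurable fun y => γn n y D)
    (hγn_prob : ∀ n y, IsProbabilityMeasure (γn n y))
    (hγ_meas : ∀ D : Set U, MeasurableSet D → Measurable fun y => γ y D)
    (hγ_prob : ∀ y, IsProbabilityMeasure (γ y))
    (hconv : ∀ g : Y → H, Integrable g μ →
      Tendsto (fun n => ∫ y, ⟪∫ u, Φ u ∂(γn n y), g y⟫ ∂μ) atTop
        (𝓝 (∫ y, ⟪∫ u, Φ u ∂(γ y), g y⟫ ∂μ))) :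
    ∀ (q : ℝ), 1 ≤ q →
      Tendsto (fun n => ∫ y, ‖(∫ u, Φ u ∂(γn n y)) - ∫ u, Φ u ∂(γ y)‖ ^ q ∂μ) atTop
        (𝓝 0) := by
  intro q hq
  obtain ⟨C, hC⟩ := hfn_bdd
  have hfn_norm : ∀ n p, ‖fn n p‖ ≤ C := fun n p => by
    rw [Real.norm_of_nonneg (hfn_nonneg n p)]
    exact hC n p
  have hfn_cont : ∀ n y, Continuous fun u => fn n (u, y) := fun n y =>
    (hfn_equicont.continuous n).comp (Continuous.prodMk_left y)
  have hdensity : ∀ n y, ∫ u, Φ u ∂(γn n y) = ∫ u, fn n (u, y) • Φ u ∂ξ := fun n y => by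
    rw [hγn_def, integral_withDensity_ofReal (hfn_cont n y).measurable fun u => hfn_nonneg n (u, y)]
  have hdensity_mul : ∀ (g : U → ℝ) n y,
      ∫ u, g u ∂(γn n y) = ∫ u, fn n (u, y) * g u ∂ξ := fun g n y => by
    simp_rw [hγn_def, ← smul_eq_mul,
      integral_withDensity_ofReal (hfn_cont n y).measurable fun u => hfn_nonneg n (u, y)]
  let κ : ℕ → ProbabilityTheory.Kernel Y U := fun n =>
    ⟨γn n, Measure.measurable_of_measurable_coe _ (hγn_meas n)⟩
  let κ₀ : ProbabilityTheory.Kernel Y U := ⟨γ, Measure.measurable_of_measurable_coe _ hγ_meas⟩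
  have : ∀ n, ProbabilityTheory.IsMarkovKernel (κ n) := fun n => ⟨hγn_prob n⟩
  have : ProbabilityTheory.IsMarkovKernel κ₀ := ⟨hγ_prob⟩
  have hI_meas : ∀ n, AEStronglyMeasurable (fun y => ∫ u, Φ u ∂(γn n y)) μ := fun n =>
    (StronglyMeasurable.integral_kernel (κ := κ n)
      hΦ_cont.stronglyMeasurable).aestronglyMeasurable
  have hI₀_meas : AEStronglyMeasurable (fun y => ∫ u, Φ u ∂(γ y)) μ :=
    (StronglyMeasurable.integral_kernel (κ := κ₀)
      hΦ_cont.stronglyMeasurable).aestronglyMeasurable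
  have hI_le : ∀ (ν : Measure U) [IsProbabilityMeasure ν], ‖∫ u, Φ u ∂ν‖ ≤ M := fun ν _ => by
    simpa using norm_integral_le_of_norm_le_const (μ := ν) (Eventually.of_forall hM)
  have hcauchy : ∀ (φ : C₀(U, ℝ)) (V : Set Y), MeasurableSet V →
      CauchySeq fun n => ∫ y in V, ∫ u, fn n (u, y) * φ u ∂ξ ∂μ := fun φ V hV => by
    simp_rw [← hdensity_mul]
    exact cauchySeq_setIntegral_integral_of_denseRange hΦ_cont hM hT hT_dense κ
      (fun g hg => (hconv g hg).cauchySeq) φ hV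
  have hmeas : ∀ n (φ : C₀(U, ℝ)),
      AEStronglyMeasurable (fun y => ∫ u, fn n (u, y) * φ u ∂ξ) μ := fun n φ => by
    simp_rw [← hdensity_mul]
    exact (StronglyMeasurable.integral_kernel (κ := κ n)
      (map_continuous φ).stronglyMeasurable).aestronglyMeasurable
  have hlim : ∀ᵐ y ∂μ, Tendsto (fun n => ∫ u, Φ u ∂(γn n y)) atTop
      (𝓝 (∫ u, limUnder atTop (fun n => fn n (u, y)) • Φ u ∂ξ)) := by
    filter_upwards [Measure.support_mem_ae (μ := μ)] with y hy
    simp_rw [hdensity]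
    refine tendsto_integral_of_dominated_convergence (fun _ => C * M)
      (fun n => ((hfn_cont n y).smul hΦ_cont).aestronglyMeasurable) (integrable_const _)
      (fun n => Eventually.of_forall fun u => ?_) ?_
    · rw [norm_smul]
      exact mul_le_mul (hfn_norm _ _) (hM u) (norm_nonneg _)
        ((norm_nonneg _).trans (hfn_norm n (u, y)))
    · filter_upwards [Measure.support_mem_ae (μ := ξ)] with u hu
      have hcs := hfn_equicont.cauchySeq_of_mem_support hfn_norm hmeas hcauchy hu hy
      exact hcs.tendsto_limUnder.smul_const _
  have hae := ae_eq_of_tendsto_ae_of_tendsto_integral_inner hI_meas (fun n y => hI_le _)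
    hI₀_meas (fun y => hI_le _) hlim hconv
  have hq0 : 0 < q := by linarith
  rw [← integral_zero Y ℝ (μ := μ)]
  refine tendsto_integral_of_dominated_convergence (fun _ => (M + M) ^ q)
    (fun n => ((hI_meas n).sub hI₀_meas).norm.aemeasurable.pow_const q |>.aestronglyMeasurable)
    (integrable_const _) (fun n => Eventually.of_forall fun y => ?_) ?_
  · rw [Real.norm_of_nonneg (by positivity)]
    exact Real.rpow_le_rpow (norm_nonneg _)
      ((norm_sub_le _ _).trans (add_le_add (hI_le _) (hI_le _))) hq0.le
  · filter_upwards [hlim, hae] with y hy hy'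
    rw [hy'] at hy
    simpa [Real.zero_rpow hq0.ne'] using
      ((hy.sub_const (∫ u, Φ u ∂(γ y))).norm).rpow_const (Or.inr hq0.le)
end

section
/- Let G ⊆ P(U) be tight: for every ε > 0 there exists a compact set K ⊆ U with sup_{ν ∈ G} ν(U ∖ K) < ε. Let γ_n (n ∈ ℕ) be stochastic kernels from Y to U with γ_n(y) ∈ G for μ-almost every y, and let γ : Y → M(U) be a weakly* measurable map (y ↦ ∫ g dγ(y) measurable for each g ∈ C₀(U)) such that γ(y) is a nonnegative sub-probability measure for every y. If ∫_Y ∫_U f(y)(u) γ_n(y)(du) dμ(y) → ∫_Y ∫_U f(y)(u) γ(y)(du) dμ(y) for every f ∈ L¹(μ, C₀(U)), then γ(y) is a probability measure for μ-almost every y; that is, the w*-closure of the set of stochastic kernels taking values in G is contained in the set of stochastic kernels. -/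
open MeasureTheory Filter Topology
open scoped ZeroAtInfty

/-- In a locally compact Hausdorff space, the indicator of a compact set is dominated by a
`[0, 1]`-valued continuous function vanishing at infinity. -/
theorem IsCompact.exists_zeroAtInfty_eq_one {U : Type*} [TopologicalSpace U] [T2Space U]
    [LocallyCompactSpace U] {K : Set U} (hK : IsCompact K) :
    ∃ g : C₀(U, ℝ), (∀ u ∈ K, g u = 1) ∧ ∀ u, g u ∈ Set.Icc (0 : ℝ) 1 := by
  obtain ⟨g, hg1, -, hgc, hg⟩ :=
    exists_continuous_one_zero_of_isCompact hK isClosed_empty (Set.disjoint_empty K)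
  let f : CompactlySupportedContinuousMap U ℝ := ⟨g, hgc⟩
  exact ⟨⟨g, HasCompactSupport.is_zero_at_infty (f := f) hgc⟩, hg1, hg⟩

/-- A function bounded by `1` is a.e. at least `1` if it dominates measurable functions
`φ k` with values in `[0, 1]` whose integrals get arbitrarily close to `1`. -/
theorem ae_one_le_of_integral_ge {Y : Type*} [MeasurableSpace Y] {μ : Measure Y}
    [IsProbabilityMeasure μ] {h : Y → ℝ} (φ : ℝ → Y → ℝ) (hφm : ∀ ε, 0 < ε → Measurable (φ ε))
    (hφ : ∀ ε, 0 < ε → ∀ y, φ ε y ∈ Set.Icc (0 : ℝ) 1) (hφh : ∀ ε, 0 < ε → ∀ y, φ ε y ≤ h y)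
    (hint : ∀ ε, 0 < ε → 1 - ε ≤ ∫ y, φ ε y ∂μ) : ∀ᵐ y ∂μ, 1 ≤ h y := by
  let e : ℕ → ℝ := fun k => 1 / ((k : ℝ) + 1)
  have he : ∀ k, 0 < e k := fun k => by positivity
  let L : Y → ENNReal := fun y => ⨅ k, ENNReal.ofReal (1 - φ (e k) y)
  have hLm : Measurable L := Measurable.iInf fun k =>
    (measurable_const.sub (hφm _ (he k))).ennreal_ofReal
  have hL : ∀ k, ∫⁻ y, L y ∂μ ≤ ENNReal.ofReal (e k) := fun k => by
    have hi : Integrable (φ (e k)) μ :=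
      Integrable.of_mem_Icc 0 1 (hφm _ (he k)).aemeasurable (ae_of_all _ (hφ _ (he k)))
    calc ∫⁻ y, L y ∂μ ≤ ∫⁻ y, ENNReal.ofReal (1 - φ (e k) y) ∂μ :=
          lintegral_mono fun y => iInf_le _ k
      _ = ENNReal.ofReal (∫ y, (1 - φ (e k) y) ∂μ) :=
          (ofReal_integral_eq_lintegral_ofReal ((integrable_const 1).sub hi)
            (ae_of_all _ fun y => sub_nonneg.2 (hφ _ (he k) y).2)).symm
      _ ≤ ENNReal.ofReal (e k) := by
          apply ENNReal.ofReal_le_ofReal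
          rw [integral_sub (integrable_const 1) hi]
          have := hint _ (he k)
          simp only [integral_const, probReal_univ, smul_eq_mul, mul_one]
          linarith
  have hL0 : ∫⁻ y, L y ∂μ = 0 := by
    have ht : Tendsto (fun k => ENNReal.ofReal (e k)) atTop (𝓝 0) := by
      simpa [e] using ENNReal.tendsto_ofReal (tendsto_one_div_add_atTop_nhds_zero_nat (𝕜 := ℝ))
    exact le_antisymm (ge_of_tendsto' ht hL) zero_le
  filter_upwards [(lintegral_eq_zero_iff hLm).1 hL0] with y hy
  have : ENNReal.ofReal (1 - h y) ≤ L y :=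
    le_iInf fun k => ENNReal.ofReal_le_ofReal (by linarith [hφh _ (he k) y])
  rw [hy] at this
  have := ENNReal.ofReal_eq_zero.1 (le_antisymm this zero_le)
  linarith

/-- Let `G ⊆ P(U)` be tight.  If stochastic kernels `γₙ` taking values in `G`
(`μ`-a.e.) converge in the `w*`-topology (testing against all `f ∈ L¹(μ, C₀(U))`) to a
weakly* measurable sub-probability valued map `γ`, then `γ(y)` is a probability measure for
`μ`-a.e. `y`: the `w*`-closure of the set of `G`-valued stochastic kernels is contained in
the set of stochastic kernels. -/
theorem stmt16
    {Y U : Type*} [TopologicalSpace Y] [PolishSpace Y] [MeasurableSpace Y] [BorelSpace Y]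
    [TopologicalSpace U] [PolishSpace U] [LocallyCompactSpace U]
    [MeasurableSpace U] [BorelSpace U]
    (μ : Measure Y) [IsProbabilityMeasure μ]
    (G : Set (Measure U)) (hG_prob : ∀ ν ∈ G, IsProbabilityMeasure ν)
    (hG_tight : ∀ ε : ℝ, 0 < ε → ∃ K : Set U, IsCompact K ∧
      (⨆ ν ∈ G, ν (Set.univ \ K)) < ENNReal.ofReal ε)
    (γn : ℕ → Y → Measure U)
    (hγn_meas : ∀ n, ∀ D : Set U, MeasurableSet D → Measurable fun y => γn n y D)
    (hγn_prob : ∀ n y, IsProbabilityMeasure (γn n y))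
    (hγn_G : ∀ n, ∀ᵐ y ∂μ, γn n y ∈ G)
    (γ : Y → Measure U)
    (hγ_wm : ∀ g : C₀(U, ℝ), Measurable fun y => ∫ u, g u ∂(γ y))
    (hγ_sub : ∀ y, γ y Set.univ ≤ 1)
    (hconv : ∀ f : Y → C₀(U, ℝ), Integrable f μ →
      Tendsto (fun n => ∫ y, ∫ u, f y u ∂(γn n y) ∂μ) atTop
        (𝓝 (∫ y, ∫ u, f y u ∂(γ y) ∂μ))) :
    ∀ᵐ y ∂μ, IsProbabilityMeasure (γ y) := by
  have hfin : ∀ y, IsFiniteMeasure (γ y) := fun y => ⟨(hγ_sub y).trans_lt ENNReal.one_lt_top⟩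
  have hmem : ∀ (ν : Measure U) [IsFiniteMeasure ν] (g : C₀(U, ℝ)),
      (∀ u, g u ∈ Set.Icc (0 : ℝ) 1) → Integrable (fun u => g u) ν := fun ν _ g hg =>
    Integrable.of_mem_Icc 0 1 g.continuous.measurable.aemeasurable (ae_of_all _ hg)
  have hle : ∀ (ν : Measure U) [IsFiniteMeasure ν] (g : C₀(U, ℝ)),
      (∀ u, g u ∈ Set.Icc (0 : ℝ) 1) → ∫ u, g u ∂ν ≤ ν.real Set.univ := fun ν _ g hg => by
    simpa using integral_mono (hmem ν g hg) (integrable_const 1) fun u => (hg u).2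
  have hγ_real : ∀ y, (γ y).real Set.univ ≤ 1 := fun y =>
    ENNReal.toReal_le_of_le_ofReal zero_le_one (by simpa using hγ_sub y)
  have hex : ∀ ε : ℝ, 0 < ε → ∃ g : C₀(U, ℝ), (∀ u, g u ∈ Set.Icc (0 : ℝ) 1) ∧
      1 - ε ≤ ∫ y, ∫ u, g u ∂(γ y) ∂μ := fun ε hε => by
    obtain ⟨K, hK, hKε⟩ := hG_tight ε hε
    obtain ⟨g, hg1, hg⟩ := hK.exists_zeroAtInfty_eq_one
    refine ⟨g, hg, ge_of_tendsto' (hconv (fun _ => g) (integrable_const g)) fun n => ?_⟩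
    let κ : ProbabilityTheory.Kernel Y U :=
      ⟨γn n, Measure.measurable_of_measurable_coe _ (hγn_meas n)⟩
    have : ProbabilityTheory.IsMarkovKernel κ := ⟨hγn_prob n⟩
    have hm : Measurable fun y => ∫ u, g u ∂(γn n y) :=
      (g.continuous.stronglyMeasurable.integral_kernel (κ := κ)).measurable
    have hi : Integrable (fun y => ∫ u, g u ∂(γn n y)) μ := by
      refine Integrable.of_mem_Icc 0 1 hm.aemeasurable (ae_of_all _ fun y => ?_)
      have := hγn_prob n y
      exact ⟨integral_nonneg fun u => (hg u).1, by simpa using hle (γn n y) g hg⟩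
    have hlow : ∀ᵐ y ∂μ, 1 - ε ≤ ∫ u, g u ∂(γn n y) := by
      filter_upwards [hγn_G n] with y hy
      have := hγn_prob n y
      have hKc : (γn n y).real Kᶜ ≤ ε := by
        refine ENNReal.toReal_le_of_le_ofReal hε.le ?_
        rw [Set.compl_eq_univ_sdiff]
        exact (le_iSup₂ (f := fun ν (_ : ν ∈ G) => ν (Set.univ \ K)) _ hy).trans hKε.le
      rw [probReal_compl_eq_one_sub hK.measurableSet] at hKc
      have hind : (γn n y).real K ≤ ∫ u, g u ∂(γn n y) := by
        rw [← integral_indicator_one hK.measurableSet]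
        refine integral_mono ((integrable_const 1).indicator hK.measurableSet)
          (hmem _ g hg) fun u => ?_
        by_cases hu : u ∈ K
        · simp [hu, hg1 u hu]
        · simpa [hu] using (hg u).1
      linarith
    simpa using integral_mono_ae (integrable_const (1 - ε)) hi hlow
  choose! g hg hgint using hex
  have hone := ae_one_le_of_integral_ge (μ := μ) (h := fun y => (γ y).real Set.univ)
    (fun ε y => ∫ u, g ε u ∂(γ y)) (fun ε _ => hγ_wm (g ε))
    (fun ε hε y => ⟨integral_nonneg fun u => (hg ε hε u).1,
      (hle (γ y) _ (hg ε hε)).trans (hγ_real y)⟩)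
    (fun ε hε y => hle (γ y) _ (hg ε hε)) hgint
  filter_upwards [hone] with y hy
  refine ⟨le_antisymm (hγ_sub y) ?_⟩
  simpa using (ENNReal.ofReal_le_iff_le_toReal (measure_ne_top _ _)).2 hy
end

section
/- Let G ⊆ P(U). Then G is tight (for every ε > 0 there exists a compact set K ⊆ U with sup_{ν ∈ G} ν(U ∖ K) < ε) if and only if every sequence (γ_n) of stochastic kernels from Y to U with γ_n(y) ∈ G for μ-almost every y admits a subsequence (γ_{n_k}) and a stochastic kernel γ such that γ_{n_k} converges to γ in the Young narrow topology, i.e., ∫_Y ∫_U f(y)(u) γ_{n_k}(y)(du) dμ(y) → ∫_Y ∫_U f(y)(u) γ(y)(du) dμ(y) for every f ∈ L¹(μ, C_b(U)). -/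
open MeasureTheory Filter Topology

open ProbabilityTheory BoundedContinuousFunction

lemma isCompact_closure_of_forall_seq_exists_subseq_tendsto {X : Type*} [TopologicalSpace X]
    [TopologicalSpace.PseudoMetrizableSpace X] {S : Set X} (h : ∀ x : ℕ → X, (∀ n, x n ∈ S) →
      ∃ (φ : ℕ → ℕ) (a : X), StrictMono φ ∧ Tendsto (x ∘ φ) atTop (𝓝 a)) :
    IsCompact (closure S) := by
  let := TopologicalSpace.pseudoMetrizableSpacePseudoMetric X
  refine IsSeqCompact.isCompact fun x hx => ?_
  choose y hyS hxy using fun n => Metric.mem_closure_iff.1 (hx n) (1 / ((n : ℝ) + 1))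
    Nat.one_div_pos_of_nat
  obtain ⟨φ, a, hφ, ha⟩ := h y hyS
  refine ⟨a, mem_closure_of_tendsto ha (Eventually.of_forall fun n => hyS _), φ, hφ, ?_⟩
  refine ha.congr_dist (squeeze_zero (fun _ => dist_nonneg) (fun n => ?_)
    (tendsto_one_div_add_atTop_nhds_zero_nat.comp hφ.tendsto_atTop))
  rw [dist_comm]
  exact (hxy (φ n)).le

lemma measurePreserving_fst_compProd {Y U : Type*} [MeasurableSpace Y] [MeasurableSpace U]
    {μ : Measure Y} [SFinite μ] (κ : Kernel Y U) [IsMarkovKernel κ] :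
    MeasurePreserving Prod.fst (μ ⊗ₘ κ) μ :=
  ⟨measurable_fst, Measure.fst_compProd μ κ⟩

section Kernel

variable {Y U : Type*} [MeasurableSpace Y] [TopologicalSpace U] [SecondCountableTopology U]
  [TopologicalSpace.PseudoMetrizableSpace U] [MeasurableSpace U] [BorelSpace U]
  {μ : Measure Y} [IsFiniteMeasure μ] (κ : Kernel Y U) [IsMarkovKernel κ]

lemma MeasureTheory.Integrable.eval_compProd {f : Y → U →ᵇ ℝ} (hf : Integrable f μ) :
    Integrable (fun p : Y × U => f p.1 p.2) (μ ⊗ₘ κ) := by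
  have hfst := measurePreserving_fst_compProd (μ := μ) κ
  have hint : Integrable (fun p : Y × U => f p.1) (μ ⊗ₘ κ) := hfst.integrable_comp_of_integrable hf
  refine hint.norm.mono ?_ (Eventually.of_forall fun p => ?_)
  · have hsnd : AEStronglyMeasurable (fun p : Y × U => p.2) (μ ⊗ₘ κ) :=
      measurable_snd.aestronglyMeasurable
    have hev : Continuous fun q : (U →ᵇ ℝ) × U => q.1 q.2 := continuous_eval
    exact hev.comp_aestronglyMeasurable (hint.1.prodMk hsnd)
  · simpa using (f p.1).norm_coe_le_norm p.2

lemma norm_integral_integral_sub_le {f g : Y → U →ᵇ ℝ} (hf : Integrable f μ)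
    (hg : Integrable g μ) :
    ‖∫ y, ∫ u, f y u ∂κ y ∂μ - ∫ y, ∫ u, g y u ∂κ y ∂μ‖ ≤ ∫ y, ‖f y - g y‖ ∂μ := by
  have hfst := measurePreserving_fst_compProd (μ := μ) κ
  have hf' := hf.eval_compProd κ
  have hg' := hg.eval_compProd κ
  have hn : Integrable (fun y => ‖f y - g y‖) μ := (hf.sub hg).norm
  rw [← Measure.integral_compProd hf', ← Measure.integral_compProd hg', ← integral_sub hf' hg']
  calc _ ≤ ∫ p, ‖f p.1 p.2 - g p.1 p.2‖ ∂(μ ⊗ₘ κ) := norm_integral_le_integral_norm _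
    _ ≤ ∫ p, ‖f p.1 - g p.1‖ ∂(μ ⊗ₘ κ) :=
      integral_mono (hf'.sub hg').norm (hfst.integrable_comp_of_integrable hn) fun p =>
        (f p.1 - g p.1).norm_coe_le_norm p.2
    _ = ∫ y, ‖f y - g y‖ ∂μ := by
      conv_rhs => rw [← hfst.map_eq]
      rw [integral_map hfst.measurable.aemeasurable]
      rw [hfst.map_eq]
      exact hn.1

lemma integral_snd_compProd (g : U →ᵇ ℝ) :
    ∫ u, g u ∂(μ ⊗ₘ κ).snd = ∫ y, ∫ u, g u ∂κ y ∂μ := by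
  rw [Measure.snd, integral_map measurable_snd.aemeasurable
    g.continuous.measurable.aestronglyMeasurable]
  exact Measure.integral_compProd ((integrable_const g).eval_compProd κ)

end Kernel

section Young

variable {Y U : Type*} [TopologicalSpace Y] [PolishSpace Y] [MeasurableSpace Y] [BorelSpace Y]
  [TopologicalSpace U] [PolishSpace U] [MeasurableSpace U] [BorelSpace U]
  {μ : Measure Y} [IsProbabilityMeasure μ]

lemma tendsto_integral_integral_of_tendsto_integral_compProd {ι : Type*} {l : Filter ι}
    {κ : ι → Kernel Y U} [∀ i, IsMarkovKernel (κ i)] {η : Kernel Y U} [IsMarkovKernel η]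
    (h : ∀ g : Y × U →ᵇ ℝ, Tendsto (fun i => ∫ p, g p ∂(μ ⊗ₘ κ i)) l (𝓝 (∫ p, g p ∂(μ ⊗ₘ η))))
    {f : Y → U →ᵇ ℝ} (hf : Integrable f μ) :
    Tendsto (fun i => ∫ y, ∫ u, f y u ∂κ i y ∂μ) l (𝓝 (∫ y, ∫ u, f y u ∂η y ∂μ)) := by
  rw [Metric.tendsto_nhds]
  intro ε hε
  let := TopologicalSpace.upgradeIsCompletelyMetrizable Y
  obtain ⟨g, hfg, hg⟩ := hf.exists_boundedContinuous_integral_sub_le (show 0 < ε / 3 by positivity)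
  let G : Y × U →ᵇ ℝ := BoundedContinuousFunction.ofNormedAddCommGroup (fun p => g p.1 p.2)
    ((continuous_eval (F := U →ᵇ ℝ)).comp
      ((g.continuous.comp continuous_fst).prodMk continuous_snd)) ‖g‖
    fun p => ((g p.1).norm_coe_le_norm p.2).trans (g.norm_coe_le_norm p.1)
  have hG (κ : Kernel Y U) [IsMarkovKernel κ] :
      ∫ p, G p ∂(μ ⊗ₘ κ) = ∫ y, ∫ u, g y u ∂κ y ∂μ :=
    Measure.integral_compProd (hg.eval_compProd κ)
  filter_upwards [Metric.tendsto_nhds.1 (h G) (ε / 3) (by positivity)] with i hi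
  rw [hG, hG] at hi
  have h₁ := norm_integral_integral_sub_le (κ i) hf hg
  have h₂ := norm_integral_integral_sub_le η hf hg
  rw [← dist_eq_norm] at h₁ h₂
  rw [dist_comm] at h₂
  linarith [dist_triangle4 (∫ y, ∫ u, f y u ∂κ i y ∂μ) (∫ y, ∫ u, g y u ∂κ i y ∂μ)
    (∫ y, ∫ u, g y u ∂η y ∂μ) (∫ y, ∫ u, f y u ∂η y ∂μ)]

lemma isTightMeasureSet_range_compProd {ι : Type*} (κ : ι → Kernel Y U)
    [∀ i, IsMarkovKernel (κ i)] {G : Set (Measure U)} (hG : IsTightMeasureSet G)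
    (hκ : ∀ i, ∀ᵐ y ∂μ, κ i y ∈ G) :
    IsTightMeasureSet (Set.range fun i => μ ⊗ₘ κ i) := by
  refine IsTightMeasureSet.prodMk ?_ ?_
  · refine (isTightMeasureSet_singleton (μ := μ)).subset ?_
    rintro _ ⟨_, ⟨i, rfl⟩, rfl⟩
    exact Measure.fst_compProd μ (κ i)
  · rw [isTightMeasureSet_iff_exists_isCompact_measure_compl_le] at hG ⊢
    intro ε hε
    obtain ⟨K, hK, hKG⟩ := hG ε hε
    refine ⟨K, hK, ?_⟩
    rintro _ ⟨_, ⟨i, rfl⟩, rfl⟩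
    have hKc := hK.measurableSet.compl
    rw [Measure.snd_compProd, Measure.bind_apply hKc (κ i).aemeasurable]
    calc ∫⁻ y, κ i y Kᶜ ∂μ ≤ ∫⁻ _, ε ∂μ :=
          lintegral_mono_ae ((hκ i).mono fun y hy => hKG _ hy)
      _ = ε := by simp

theorem exists_subseq_tendsto_of_isTightMeasureSet (κ : ℕ → Kernel Y U)
    [∀ n, IsMarkovKernel (κ n)] {G : Set (Measure U)} (hG : IsTightMeasureSet G)
    (hκ : ∀ n, ∀ᵐ y ∂μ, κ n y ∈ G) :
    ∃ φ : ℕ → ℕ, StrictMono φ ∧ ∃ η : Kernel Y U, IsMarkovKernel η ∧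
      ∀ f : Y → U →ᵇ ℝ, Integrable f μ →
        Tendsto (fun k => ∫ y, ∫ u, f y u ∂κ (φ k) y ∂μ) atTop
          (𝓝 (∫ y, ∫ u, f y u ∂η y ∂μ)) := by
  let P (n : ℕ) : ProbabilityMeasure (Y × U) := ⟨μ ⊗ₘ κ n, inferInstance⟩
  have hcomp : IsCompact (closure (Set.range P)) := by
    refine isCompact_closure_of_isTightMeasureSet
      ((isTightMeasureSet_range_compProd κ hG hκ).subset ?_)
    rintro _ ⟨_, ⟨n, rfl⟩, rfl⟩
    exact ⟨n, rfl⟩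
  obtain ⟨π, -, φ, hφ, hπ⟩ :=
    hcomp.tendsto_subseq fun n => subset_closure (Set.mem_range_self (f := P) n)
  have hfst : (π : Measure (Y × U)).fst = μ := by
    have hlim := (ProbabilityMeasure.continuous_map (continuous_fst (X := Y) (Y := U))).tendsto π
      |>.comp hπ
    let μ' : ProbabilityMeasure Y := ⟨μ, inferInstance⟩
    have hconst (k : ℕ) : (P (φ k)).map continuous_fst.measurable.aemeasurable = μ' :=
      Subtype.ext (Measure.fst_compProd μ (κ (φ k)))
    exact congrArg (fun ν : ProbabilityMeasure Y => (ν : Measure Y))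
      (tendsto_nhds_unique hlim (tendsto_const_nhds.congr fun k => (hconst k).symm))
  have : Nonempty Y := nonempty_of_isProbabilityMeasure μ
  have : Nonempty U := nonempty_of_isProbabilityMeasure (κ 0 (Classical.arbitrary Y))
  have hdis : μ ⊗ₘ (π : Measure (Y × U)).condKernel = π := by
    conv_lhs => rw [← hfst]
    exact (π : Measure (Y × U)).disintegrate _
  refine ⟨φ, hφ, (π : Measure (Y × U)).condKernel, inferInstance, fun f hf => ?_⟩
  refine tendsto_integral_integral_of_tendsto_integral_compProd (κ := fun k => κ (φ k))
    (fun g => ?_) hf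
  rw [hdis]
  exact ProbabilityMeasure.tendsto_iff_forall_integral_tendsto.1 hπ g

end Young

lemma isTightMeasureSet_iff_forall_exists_iSup_lt {U : Type*} [TopologicalSpace U]
    [MeasurableSpace U] {G : Set (Measure U)} :
    IsTightMeasureSet G ↔ ∀ ε : ℝ, 0 < ε → ∃ K : Set U, IsCompact K ∧
      (⨆ ν ∈ G, ν (Set.univ \ K)) < ENNReal.ofReal ε := by
  simp only [← Set.compl_eq_univ_sdiff]
  rw [isTightMeasureSet_iff_exists_isCompact_measure_compl_le]
  constructor
  · intro h ε hε
    obtain ⟨K, hK, hle⟩ := h (ENNReal.ofReal (ε / 2)) (by simpa using hε)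
    exact ⟨K, hK, (iSup₂_le hle).trans_lt
      ((ENNReal.ofReal_lt_ofReal_iff hε).2 (half_lt_self hε))⟩
  · intro h ε hε
    obtain ⟨δ, hδ, hδε⟩ := ENNReal.lt_iff_exists_real_btwn.1 hε
    obtain ⟨K, hK, hlt⟩ := h δ (ENNReal.ofReal_pos.1 hδε.1)
    exact ⟨K, hK, fun ν hν => (le_iSup₂ (f := fun ν _ => ν Kᶜ) ν hν).trans (hlt.le.trans hδε.2.le)⟩

theorem stmt17
    {Y U : Type*} [TopologicalSpace Y] [PolishSpace Y] [MeasurableSpace Y] [BorelSpace Y]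
    [TopologicalSpace U] [PolishSpace U] [LocallyCompactSpace U]
    [MeasurableSpace U] [BorelSpace U]
    (μ : Measure Y) [IsProbabilityMeasure μ]
    (G : Set (Measure U)) (hG_prob : ∀ ν ∈ G, IsProbabilityMeasure ν) :
    (∀ ε : ℝ, 0 < ε → ∃ K : Set U, IsCompact K ∧
      (⨆ ν ∈ G, ν (Set.univ \ K)) < ENNReal.ofReal ε)
    ↔ (∀ γn : ℕ → Y → Measure U,
      (∀ n, ∀ D : Set U, MeasurableSet D → Measurable fun y => γn n y D) →
      (∀ n y, IsProbabilityMeasure (γn n y)) →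
      (∀ n, ∀ᵐ y ∂μ, γn n y ∈ G) →
      ∃ φ : ℕ → ℕ, StrictMono φ ∧
        ∃ γ : Y → Measure U,
          (∀ D : Set U, MeasurableSet D → Measurable fun y => γ y D) ∧
          (∀ y, IsProbabilityMeasure (γ y)) ∧
          ∀ f : Y → BoundedContinuousFunction U ℝ, Integrable f μ →
            Tendsto (fun k => ∫ y, ∫ u, f y u ∂(γn (φ k) y) ∂μ) atTop
              (𝓝 (∫ y, ∫ u, f y u ∂(γ y) ∂μ))) := by
  rw [← isTightMeasureSet_iff_forall_exists_iSup_lt]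
  constructor
  · intro hG γn hmeas hprob hmem
    let κ (n : ℕ) : Kernel Y U := ⟨γn n, Measure.measurable_of_measurable_coe _ (hmeas n)⟩
    have (n : ℕ) : IsMarkovKernel (κ n) := ⟨hprob n⟩
    obtain ⟨φ, hφ, η, hη, hlim⟩ := exists_subseq_tendsto_of_isTightMeasureSet κ hG hmem
    exact ⟨φ, hφ, η, fun D hD => η.measurable_coe hD, hη.isProbabilityMeasure, hlim⟩
  · intro h
    let S : Set (ProbabilityMeasure U) := {ν | (ν : Measure U) ∈ G}
    let := TopologicalSpace.upgradeIsCompletelyMetrizable U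
    have hS : IsCompact (closure S) := by
      refine isCompact_closure_of_forall_seq_exists_subseq_tendsto fun ν hν => ?_
      obtain ⟨φ, hφ, γ, hmeas, hprob, hlim⟩ := h (fun n _ => ν n) (fun _ _ _ => measurable_const)
        (fun _ _ => inferInstance) fun n => Eventually.of_forall fun _ => hν n
      let κ : Kernel Y U := ⟨γ, Measure.measurable_of_measurable_coe _ hmeas⟩
      have : IsMarkovKernel κ := ⟨hprob⟩
      let ρ : ProbabilityMeasure U := ⟨(μ ⊗ₘ κ).snd, inferInstance⟩
      refine ⟨φ, ρ, hφ, ?_⟩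
      rw [ProbabilityMeasure.tendsto_iff_forall_integral_tendsto]
      intro g
      have hg := hlim (fun _ => g) (integrable_const g)
      simp only [integral_const, probReal_univ, one_smul] at hg
      have hρ : ∫ u, g u ∂(ρ : Measure U) = ∫ y, ∫ u, g u ∂γ y ∂μ := integral_snd_compProd κ g
      rwa [← hρ] at hg
    exact (isTightMeasureSet_of_isCompact_closure hS).subset fun ν hν =>
      ⟨⟨ν, hG_prob ν hν⟩, hν, rfl⟩
end
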